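/- arXiv:2110.10410 — 3 statements merged into one kernel-verified Lean document; each statement's English description precedes it below -/
import Mathlib

section
/- For all integers n and k with n ≥ k ≥ 3, the outerplanar Turán number of the cycle C_k satisfies ex_OP(n, C_k) = f(n,k), where λ = ⌊(kn − 2k − 1)/(k² − 2k − 1)⌋ + 1, and f(n,k) = 2n − λ + 2⌊λ/k⌋ − 3 if k divides λ, and f(n,k) = 2n − λ + 2⌊λ/k⌋ − 2 otherwise. -/
/-- A simple graph is outerplanar if it admits a one-page book embedding:
an injective integer labeling of the vertices such that no two edges interleave. -/
def IsOuterplanar {V : Type*} (G : SimpleGraph V) : Prop :=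
  ∃ f : V → ℤ, Function.Injective f ∧
    ∀ a b c d : V, G.Adj a b → G.Adj c d →
      ¬(f a < f c ∧ f c < f b ∧ f b < f d)

/-- `G` contains a subgraph isomorphic to `H`. -/
def ContainsCopy {W V : Type*} (H : SimpleGraph W) (G : SimpleGraph V) : Prop :=
  ∃ φ : H →g G, Function.Injective φ

/-- The outerplanar Turán number: maximum number of edges of an `H`-free
outerplanar graph on `n` vertices. -/
noncomputable def exOP (n : ℕ) {W : Type*} (H : SimpleGraph W) : ℕ :=
  sSup {m : ℕ | ∃ G : SimpleGraph (Fin n),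
    IsOuterplanar G ∧ ¬ ContainsCopy H G ∧ m = G.edgeSet.ncard}

namespace OPT

/-- Edges listed as ordered pairs `(u, v)` with `u < v`. -/
def Ord (S : Finset (ℕ × ℕ)) : Prop := ∀ u v, (u, v) ∈ S → u < v

/-- No two edges interleave. -/
def NC (S : Finset (ℕ × ℕ)) : Prop :=
  ∀ a b c d, (a, b) ∈ S → (c, d) ∈ S → ¬ (a < c ∧ c < b ∧ b < d)

/-- Monotone chains of edges: from, to, length. -/
inductive MC (S : Finset (ℕ × ℕ)) : ℕ → ℕ → ℕ → Prop
  | nil (a : ℕ) : MC S a a 0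
  | cons {a x b m : ℕ} : (a, x) ∈ S → MC S x b m → MC S a b (m + 1)

/-- No monotone closed chain with `k` vertices. -/
def CF (S : Finset (ℕ × ℕ)) (k : ℕ) : Prop :=
  ∀ a b, (a, b) ∈ S → ¬ MC S a b (k - 1)

/-- Symmetric adjacency. -/
def Sym (S : Finset (ℕ × ℕ)) (u v : ℕ) : Prop := (u, v) ∈ S ∨ (v, u) ∈ S

lemma MC.le {S : Finset (ℕ × ℕ)} (hS : Ord S) {a b m : ℕ} (h : MC S a b m) : a + m ≤ b := by
  induction h with
  | nil a => omega
  | cons h1 _ ih => have := hS _ _ h1; omega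

lemma MC.append {S : Finset (ℕ × ℕ)} {a b c m m' : ℕ} (h : MC S a b m) (h' : MC S b c m') :
    MC S a c (m + m') := by
  induction h with
  | nil a => simpa using h'
  | cons h1 _ ih =>
    have := MC.cons h1 (ih h')
    rwa [Nat.add_right_comm] at this

/-- Chain to function. -/
lemma MC.fn {S : Finset (ℕ × ℕ)} {a b m : ℕ} (h : MC S a b m) :
    ∃ g : ℕ → ℕ, g 0 = a ∧ g m = b ∧ ∀ i < m, (g i, g (i + 1)) ∈ S := by
  induction h with
  | nil a => exact ⟨fun _ => a, rfl, rfl, by simp⟩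
  | @cons a x b m h1 _ ih =>
    obtain ⟨g, h0, hm, hg⟩ := ih
    refine ⟨fun i => if i = 0 then a else g (i - 1), by simp, by simpa using hm, ?_⟩
    intro i hi
    rcases Nat.eq_zero_or_pos i with rfl | hp
    · simpa [h0] using h1
    · have := hg (i - 1) (by omega)
      have e : i - 1 + 1 = i := by omega
      rw [e] at this
      simpa [hp.ne'] using this

/-- Function to chain. -/
lemma MC.of_fn {S : Finset (ℕ × ℕ)} (g : ℕ → ℕ) (m : ℕ) :
    ∀ i, (∀ j, i ≤ j → j < i + m → (g j, g (j + 1)) ∈ S) → MC S (g i) (g (i + m)) m := by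
  induction m with
  | zero => intro i _; exact MC.nil _
  | succ m ih =>
    intro i h
    have h2 := ih (i + 1) (fun j h1 h2 => h j (by omega) (by omega))
    have e : i + 1 + m = i + (m + 1) := by omega
    rw [e] at h2
    exact MC.cons (h i le_rfl (by omega)) h2

lemma stay {S : Finset (ℕ × ℕ)} (hO : Ord S) (hN : NC S) {u v x y : ℕ} (huv : (u, v) ∈ S)
    (hxy : Sym S x y) (hx : u < x) (hx' : x < v) (hyu : y ≠ u) (hyv : y ≠ v) : u < y ∧ y < v := by
  rcases hxy with h | h
  · have := hN _ _ _ _ huv h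
    have := hO _ _ h
    omega
  · have := hN _ _ _ _ h huv
    have := hO _ _ h
    omega

/-- A closed noncrossing cycle, started at its minimum in the right direction, is monotone. -/
lemma core {S : Finset (ℕ × ℕ)} (hO : Ord S) (hN : NC S) (k : ℕ) (hk : 3 ≤ k) (p : ℕ → ℕ)
    (hadj : ∀ i < k, Sym S (p i) (p (i + 1))) (hper : p k = p 0)
    (hinj : ∀ i < k, ∀ j < k, p i = p j → i = j) (hmin : ∀ i < k, p 0 ≤ p i)
    (hdir : p 1 < p (k - 1)) : ∃ a b, (a, b) ∈ S ∧ MC S a b (k - 1) := by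
  have hlt : ∀ i < k, 0 < i → p 0 < p i := fun i hi h0 =>
    lt_of_le_of_ne (hmin i hi) (fun h => by have := hinj 0 (by omega) i hi h; omega)
  have htop : (p 0, p (k - 1)) ∈ S := by
    have h := hadj (k - 1) (by omega)
    rw [show k - 1 + 1 = k by omega, hper] at h
    rcases h with h | h
    · have := hO _ _ h
      have := hlt (k - 1) (by omega) (by omega)
      omega
    · exact h
  have hin : ∀ i, 1 ≤ i → i < k - 1 → p 0 < p i ∧ p i < p (k - 1) := by
    intro i h1
    induction i, h1 using Nat.le_induction with
    | base => intro _; exact ⟨hlt 1 (by omega) (by omega), hdir⟩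
    | succ i h1 ih =>
      intro h2
      obtain ⟨h3, h4⟩ := ih (by omega)
      refine stay hO hN htop (hadj i (by omega)) h3 h4 ?_ ?_
      · intro h; have := hinj _ (by omega) _ (by omega) h; omega
      · intro h; have := hinj _ (by omega) _ (by omega) h; omega
  have hmono : ∀ i, i < k → ∀ j, i < j → j < k → p i < p j := by
    intro i
    induction i with
    | zero => intro _ j h1 h2; exact hlt j h2 h1
    | succ i ih =>
      intro hi j h1 h2
      by_contra hcon
      have hedge : (p i, p (i + 1)) ∈ S := by
        rcases hadj i (by omega) with h | h
        · exact h
        · have := hO _ _ h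
          have := ih (by omega) (i + 1) (by omega) (by omega)
          omega
      have key : ∀ d, j + d < k → p i < p (j + d) ∧ p (j + d) < p (i + 1) := by
        intro d
        induction d with
        | zero =>
          intro _
          have := ih (by omega) j (by omega) h2
          have : p (i + 1) ≠ p j := fun h => by
            have := hinj _ (by omega) _ (by omega) h; omega
          simp only [Nat.add_zero]; omega
        | succ d ihd =>
          intro hd
          obtain ⟨h3, h4⟩ := ihd (by omega)
          refine stay hO hN hedge (hadj (j + d) (by omega)) h3 h4 ?_ ?_
          · intro h; have := hinj _ (by omega) _ (by omega) h; omega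
          · intro h; have := hinj _ (by omega) _ (by omega) h; omega
      have := key (k - 1 - j) (by omega)
      rw [show j + (k - 1 - j) = k - 1 by omega] at this
      have := hin (i + 1) (by omega) (by omega)
      omega
  refine ⟨_, _, htop, ?_⟩
  have := MC.of_fn (S := S) p (k - 1) 0 (fun j _ h2 => by
    rcases hadj j (by omega) with h | h
    · exact h
    · have := hO _ _ h
      have := hmono j (by omega) (j + 1) (by omega) (by omega)
      omega)
  simpa using this

/-- Any closed noncrossing cycle yields a monotone one. -/
lemma cycle_mono {S : Finset (ℕ × ℕ)} (hO : Ord S) (hN : NC S) (k : ℕ) (hk : 3 ≤ k) (p : ℕ → ℕ)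
    (hadj : ∀ i, Sym S (p i) (p (i + 1))) (hper : ∀ i, p (i + k) = p i)
    (hinj : ∀ i j, p i = p j → i % k = j % k) : ∃ a b, (a, b) ∈ S ∧ MC S a b (k - 1) := by
  obtain ⟨s, hs, hmin⟩ := Finset.exists_min_image (Finset.range k) p ⟨0, by simp; omega⟩
  have hpm : ∀ i, p (i % k) = p i := by
    intro i
    conv_rhs => rw [← Nat.mod_add_div i k]
    generalize i / k = q
    induction q with
    | zero => simp
    | succ q ih => rw [Nat.mul_succ, ← Nat.add_assoc, hper, ih]
  have hmin' : ∀ i, p s ≤ p i := fun i => by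
    rw [← hpm i]; exact hmin _ (by simp; exact Nat.mod_lt _ (by omega))
  have hinj' : ∀ i < k, ∀ j < k, p (s + i) = p (s + j) → i = j := by
    intro i hi j hj h
    have h := hinj _ _ h
    have h2 : i ≡ j [MOD k] := Nat.ModEq.add_left_cancel' s h
    exact Nat.ModEq.eq_of_lt_of_lt h2 hi hj
  rcases lt_or_ge (p (s + 1)) (p (s + (k - 1))) with h | h
  · exact core hO hN k hk (fun i => p (s + i)) (fun i _ => hadj (s + i)) (by simpa using hper s)
      hinj' (fun i _ => by simpa using hmin' _) h
  · refine core hO hN k hk (fun i => p (s + (k - i))) (fun i hi => ?_) ?_ ?_ ?_ ?_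
    · have := hadj (s + (k - (i + 1)))
      rw [show s + (k - (i + 1)) + 1 = s + (k - i) by omega] at this
      exact this.symm
    · simpa using (hper s).symm
    · intro i hi j hj h
      rcases Nat.eq_zero_or_pos i with rfl | h1 <;> rcases Nat.eq_zero_or_pos j with rfl | h2
      · rfl
      · have h' : p (s + 0) = p (s + (k - j)) := by simpa [hper] using h
        have := hinj' _ (by omega) _ (by omega) h'; omega
      · have h' : p (s + (k - i)) = p (s + 0) := by simpa [hper] using h
        have := hinj' _ (by omega) _ (by omega) h'; omega
      · have := hinj' _ (by omega) _ (by omega) h; omega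
    · intro i _; simpa [hper] using hmin' _
    · have : p (s + 1) ≠ p (s + (k - 1)) := fun h => by
        have := hinj' _ (by omega) _ (by omega) h; omega
      simp only [show k - (k - 1) = 1 by omega]
      omega

end OPT
namespace OPT

/-- `S` represents the graph `G` through the vertex relabelling `σ`. -/
structure Rep {n : ℕ} (G : SimpleGraph (Fin n)) (σ : Fin n ≃ Fin n) (S : Finset (ℕ × ℕ)) :
    Prop where
  ord : ∀ u v, (u, v) ∈ S → u < v
  bd : ∀ u v, (u, v) ∈ S → v < n
  adj : ∀ i j : Fin n, i < j → ((i.val, j.val) ∈ S ↔ G.Adj (σ i) (σ j))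

lemma Rep.sym {n : ℕ} {G : SimpleGraph (Fin n)} {σ : Fin n ≃ Fin n} {S : Finset (ℕ × ℕ)}
    (h : Rep G σ S) (i j : Fin n) : G.Adj (σ i) (σ j) ↔ Sym S i j := by
  rcases lt_trichotomy i j with hij | hij | hij
  · rw [← h.adj i j hij, Sym]
    have : ¬ (j.val, i.val) ∈ S := fun h' => by
      have := h.ord _ _ h'; have : i.val < j.val := hij; omega
    tauto
  · subst hij
    have : ¬ (i.val, i.val) ∈ S := fun h' => by
      have := h.ord _ _ h'; omega
    simp [Sym, this]
  · rw [G.adj_comm, ← h.adj j i hij, Sym]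
    have : ¬ (i.val, j.val) ∈ S := fun h' => by
      have := h.ord _ _ h'; have : j.val < i.val := hij; omega
    tauto

lemma Rep.card {n : ℕ} {G : SimpleGraph (Fin n)} {σ : Fin n ≃ Fin n} {S : Finset (ℕ × ℕ)}
    (h : Rep G σ S) : G.edgeSet.ncard = S.card := by
  classical
  rw [← Set.ncard_coe_finset]
  symm
  refine Set.ncard_congr
    (fun p hp => s(σ ⟨p.1, (h.ord p.1 p.2 hp).trans (h.bd p.1 p.2 hp)⟩, σ ⟨p.2, h.bd p.1 p.2 hp⟩))
    ?_ ?_ ?_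
  · rintro ⟨u, v⟩ hp
    simp only [SimpleGraph.mem_edgeSet]
    rw [← h.adj _ _ (by exact h.ord u v hp)]
    exact hp
  · rintro ⟨u, v⟩ ⟨u', v'⟩ hp hp' heq
    have := h.ord _ _ hp
    have := h.ord _ _ hp'
    simp only [Sym2.eq_iff, EmbeddingLike.apply_eq_iff_eq, Fin.mk.injEq] at heq
    simp only [Prod.mk.injEq]
    omega
  · intro e
    induction e using Sym2.ind with
    | _ x y =>
      intro he
      rw [SimpleGraph.mem_edgeSet] at he
      obtain ⟨i, rfl⟩ := σ.surjective x
      obtain ⟨j, rfl⟩ := σ.surjective y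
      rcases (h.sym i j).1 he with h1 | h1
      · exact ⟨(i, j), h1, rfl⟩
      · exact ⟨(j, i), h1, Sym2.eq_swap⟩

lemma MC.copy {n k : ℕ} (hk : 3 ≤ k) {G : SimpleGraph (Fin n)} {σ : Fin n ≃ Fin n}
    {S : Finset (ℕ × ℕ)}
    (h : Rep G σ S) {a b : ℕ} (hab : (a, b) ∈ S) (hc : MC S a b (k - 1)) :
    ContainsCopy (SimpleGraph.cycleGraph k) G := by
  obtain ⟨g, h0, hm, hg⟩ := hc.fn
  have hmono : ∀ d i, i + d ≤ k - 1 → g i + d ≤ g (i + d) := by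
    intro d
    induction d with
    | zero => intro i _; simp
    | succ d ih =>
      intro i hi
      have := ih i (by omega)
      have := h.ord _ _ (hg (i + d) (by omega))
      rw [show i + (d + 1) = i + d + 1 by omega]; omega
  have hlt : ∀ i < k, g i < n := by
    intro i hi
    have := hmono (k - 1 - i) i (by omega)
    rw [show i + (k - 1 - i) = k - 1 by omega, hm] at this
    have := h.bd _ _ hab
    omega
  have hinj : ∀ i < k, ∀ j < k, g i = g j → i = j := by
    intro i hi j hj he
    rcases lt_trichotomy i j with h1 | h1 | h1
    · have := hmono (j - i) i (by omega)
      rw [show i + (j - i) = j by omega] at this; omega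
    · exact h1
    · have := hmono (i - j) j (by omega)
      rw [show j + (i - j) = i by omega] at this; omega
  have hone : ∀ u v : Fin k, (v - u).val = 1 → Sym S (g u) (g v) := by
    intro u v huv
    rcases le_or_gt u v with hle | hlt'
    · rw [Fin.sub_val_of_le hle] at huv
      have e : v.val = u.val + 1 := by omega
      rw [e]
      exact Or.inl (hg _ (by omega))
    · rw [Fin.coe_sub_iff_lt.mpr hlt'] at huv
      have := u.2
      have := v.2
      have e1 : u.val = k - 1 := by omega
      have e2 : v.val = 0 := by omega
      rw [e1, e2, h0, hm]
      exact Or.inr hab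
  refine ⟨⟨fun i => σ ⟨g i, hlt i i.2⟩, ?_⟩, ?_⟩
  · intro u v huv
    rw [h.sym]
    rcases SimpleGraph.cycleGraph_adj'.1 huv with h1 | h1
    · exact (hone v u h1).symm
    · exact hone u v h1
  · intro u v huv
    have := σ.injective huv
    simp only [Fin.mk.injEq] at this
    exact Fin.ext (hinj _ u.2 _ v.2 this)

lemma copy_MC {n k : ℕ} (hk : 3 ≤ k) {G : SimpleGraph (Fin n)} {σ : Fin n ≃ Fin n}
    {S : Finset (ℕ × ℕ)} (h : Rep G σ S) (hN : NC S)
    (hc : ContainsCopy (SimpleGraph.cycleGraph k) G) :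
    ∃ a b, (a, b) ∈ S ∧ MC S a b (k - 1) := by
  obtain ⟨φ, hφ⟩ := hc
  have hk0 : 0 < k := by omega
  refine cycle_mono h.ord hN k hk (fun i => (σ.symm (φ ⟨i % k, Nat.mod_lt _ hk0⟩)).val) ?_ ?_ ?_
  · intro i
    rw [← h.sym]
    simp only [Equiv.apply_symm_apply]
    apply φ.map_adj
    rw [SimpleGraph.cycleGraph_adj']
    right
    have h1 : i % k < k := Nat.mod_lt _ hk0
    rcases Nat.lt_or_ge (i % k + 1) k with h2 | h2
    · have e : (i + 1) % k = i % k + 1 := by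
        rw [Nat.add_mod, Nat.mod_eq_of_lt (show 1 < k by omega), Nat.mod_eq_of_lt h2]
      rw [Fin.sub_val_of_le (by simp [Fin.le_def, e])]
      simp [e]
    · have e1 : i % k = k - 1 := by omega
      have e : (i + 1) % k = 0 := by
        rw [Nat.add_mod, Nat.mod_eq_of_lt (show 1 < k by omega), e1,
          show k - 1 + 1 = k by omega, Nat.mod_self]
      rw [Fin.coe_sub_iff_lt.mpr (by simp [Fin.lt_def, e, e1]; omega)]
      simp [e, e1]; omega
  · intro i
    simp
  · intro i j hij
    have := hφ (σ.symm.injective (Fin.ext hij))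
    simpa using this

/-- From an outerplanar graph to a set of pairs. -/
lemma up {n k : ℕ} (hk : 3 ≤ k) (G : SimpleGraph (Fin n)) (hG : IsOuterplanar G)
    (hc : ¬ ContainsCopy (SimpleGraph.cycleGraph k) G) :
    ∃ S : Finset (ℕ × ℕ), Ord S ∧ (∀ u v, (u, v) ∈ S → v < n) ∧ NC S ∧ CF S k ∧
      G.edgeSet.ncard = S.card := by
  classical
  obtain ⟨f, hf, hcr⟩ := hG
  have hmono : StrictMono (f ∘ Tuple.sort f) :=
    (Tuple.monotone_sort f).strictMono_of_injective (hf.comp (Tuple.sort f).injective)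
  set σ : Fin n ≃ Fin n := Tuple.sort f
  let S : Finset (ℕ × ℕ) := ((Finset.univ : Finset (Fin n × Fin n)).filter
    (fun p => p.1 < p.2 ∧ G.Adj (σ p.1) (σ p.2))).image (fun p => (p.1.val, p.2.val))
  have hmem : ∀ u v, (u, v) ∈ S ↔ ∃ i j : Fin n, i < j ∧ G.Adj (σ i) (σ j) ∧ i.val = u ∧
      j.val = v := by
    intro u v
    simp only [S, Finset.mem_image, Finset.mem_filter, Finset.mem_univ, true_and, Prod.exists,
      Prod.mk.injEq]
    tauto
  have hR : Rep G σ S := by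
    refine ⟨?_, ?_, ?_⟩
    · intro u v h
      obtain ⟨i, j, h1, -, rfl, rfl⟩ := (hmem u v).1 h
      exact h1
    · intro u v h
      obtain ⟨i, j, h1, -, rfl, rfl⟩ := (hmem u v).1 h
      exact j.2
    · intro i j hij
      rw [hmem]
      constructor
      · rintro ⟨i', j', -, h, h1, h2⟩
        rwa [← Fin.ext h1, ← Fin.ext h2]
      · intro h
        exact ⟨i, j, hij, h, rfl, rfl⟩
  refine ⟨S, hR.ord, hR.bd, ?_, ?_, hR.card⟩
  · intro a b c d h1 h2 h3
    obtain ⟨i, j, -, h4, rfl, rfl⟩ := (hmem _ _).1 h1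
    obtain ⟨i', j', -, h5, rfl, rfl⟩ := (hmem _ _).1 h2
    exact hcr _ _ _ _ h4 h5 ⟨hmono h3.1, hmono h3.2.1, hmono h3.2.2⟩
  · intro a b hab hm
    exact hc (hm.copy hk hR hab)

/-- From a set of pairs to an outerplanar graph. -/
lemma down {n k : ℕ} (hk : 3 ≤ k) (S : Finset (ℕ × ℕ)) (hO : Ord S)
    (hb : ∀ u v, (u, v) ∈ S → v < n) (hN : NC S) (hC : CF S k) :
    ∃ G : SimpleGraph (Fin n), IsOuterplanar G ∧
      ¬ ContainsCopy (SimpleGraph.cycleGraph k) G ∧ S.card = G.edgeSet.ncard := by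
  let G : SimpleGraph (Fin n) :=
    { Adj := fun i j => Sym S i j
      symm := ⟨fun i j h => Or.symm h⟩
      loopless := ⟨fun i h => by
        rcases h with h | h <;> exact lt_irrefl _ (hO _ _ h)⟩ }
  have hR : Rep G (Equiv.refl _) S := by
    refine ⟨hO, hb, ?_⟩
    intro i j hij
    have : ¬ (j.val, i.val) ∈ S := fun h' => by
      have := hO _ _ h'; have : i.val < j.val := hij; omega
    change _ ↔ Sym S i j
    simp [Sym, this]
  refine ⟨G, ⟨fun i => (i.val : ℤ), ?_, ?_⟩, ?_, hR.card.symm⟩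
  · intro i j h
    have h : (i.val : ℤ) = (j.val : ℤ) := h
    exact Fin.ext (by exact_mod_cast h)
  · intro a b c d h1 h2 h3
    beta_reduce at h3
    norm_cast at h3
    rcases h1 with h1 | h1 <;> rcases h2 with h2 | h2
    · exact hN _ _ _ _ h1 h2 h3
    · have := hO _ _ h2; omega
    · have := hO _ _ h1; omega
    · have := hO _ _ h1; omega
  · intro h
    obtain ⟨a, b, h1, h2⟩ := copy_MC hk hR hN h
    exact hC a b h1 h2

end OPT
namespace OPT

/-- Number of edges inside the interval `[a, b]`. -/
def E (S : Finset (ℕ × ℕ)) (a b : ℕ) : ℤ := ((S.filter (fun p => a ≤ p.1 ∧ p.2 ≤ b)).card : ℤ)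

lemma E_split {S : Finset (ℕ × ℕ)} (a x b : ℕ)
    (h : ∀ u v, (u, v) ∈ S → a ≤ u → v ≤ b → v ≤ x ∨ x ≤ u ∨ (u = a ∧ v = b)) :
    E S a b ≤ E S a x + E S x b + (if (a, b) ∈ S then 1 else 0) := by
  classical
  have hsub : S.filter (fun p => a ≤ p.1 ∧ p.2 ≤ b) ⊆
      (S.filter (fun p => a ≤ p.1 ∧ p.2 ≤ x) ∪ S.filter (fun p => x ≤ p.1 ∧ p.2 ≤ b)) ∪
        (if (a, b) ∈ S then {(a, b)} else ∅) := by
    rintro ⟨u, v⟩ hp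
    simp only [Finset.mem_filter] at hp
    obtain ⟨h1, h2, h3⟩ := hp
    simp only [Finset.mem_union, Finset.mem_filter]
    rcases h u v h1 h2 h3 with h4 | h4 | ⟨rfl, rfl⟩
    · exact Or.inl (Or.inl ⟨h1, h2, h4⟩)
    · exact Or.inl (Or.inr ⟨h1, h4, h3⟩)
    · right; simp [h1]
  have h1 := Finset.card_le_card hsub
  have h2 := Finset.card_union_le
    (S.filter (fun p => a ≤ p.1 ∧ p.2 ≤ x) ∪ S.filter (fun p => x ≤ p.1 ∧ p.2 ≤ b))
    (if (a, b) ∈ S then {(a, b)} else ∅)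
  have h3 := Finset.card_union_le
    (S.filter (fun p => a ≤ p.1 ∧ p.2 ≤ x)) (S.filter (fun p => x ≤ p.1 ∧ p.2 ≤ b))
  unfold E
  by_cases hab : (a, b) ∈ S
  · simp only [hab, if_true, Finset.card_singleton] at h1 h2 ⊢
    omega
  · simp only [hab, if_false, Finset.card_empty] at h1 h2 ⊢
    omega

lemma E_unit {S : Finset (ℕ × ℕ)} (hO : Ord S) (a : ℕ) :
    E S a (a + 1) ≤ (if (a, a + 1) ∈ S then 1 else 0) := by
  classical
  have hsub : S.filter (fun p => a ≤ p.1 ∧ p.2 ≤ a + 1) ⊆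
        (if (a, a + 1) ∈ S then {(a, a + 1)} else ∅) := by
    rintro ⟨u, v⟩ hp
    simp only [Finset.mem_filter] at hp
    obtain ⟨h1, h2, h3⟩ := hp
    have := hO _ _ h1
    obtain rfl : u = a := by omega
    obtain rfl : v = u + 1 := by omega
    simp [h1]
  have h1 := Finset.card_le_card hsub
  unfold E
  by_cases hab : (a, a + 1) ∈ S
  · simp only [hab, if_true, Finset.card_singleton] at h1 ⊢
    omega
  · simp only [hab, if_false, Finset.card_empty] at h1 ⊢
    omega

lemma exists_split {S : Finset (ℕ × ℕ)} (hO : Ord S) (hN : NC S) {a b : ℕ} (hab : a + 1 < b) :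
    ∃ x, a < x ∧ x < b ∧ ((a, x) ∈ S ∨ (x = a + 1 ∧ (a, x) ∉ S)) ∧
      E S a b ≤ E S a x + E S x b + (if (a, b) ∈ S then 1 else 0) := by
  classical
  by_cases hex : ((Finset.Ioo a b).filter (fun y => (a, y) ∈ S)).Nonempty
  · obtain ⟨x, hx, hmax⟩ := Finset.exists_max_image _ (fun y => y) hex
    simp only [Finset.mem_filter, Finset.mem_Ioo] at hx hmax
    refine ⟨x, hx.1.1, hx.1.2, Or.inl hx.2, E_split a x b ?_⟩
    intro u v huv hau hvb
    have h1 := hN _ _ _ _ hx.2 huv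
    have h2 := hO _ _ huv
    by_cases hu : u = a
    · subst hu
      by_cases hv : v = b
      · exact Or.inr (Or.inr ⟨rfl, hv⟩)
      · left; exact hmax v ⟨⟨h2, by omega⟩, huv⟩
    · omega
  · have hno : ∀ y, a < y → y < b → (a, y) ∉ S := by
      intro y h1 h2 h3
      exact hex ⟨y, by simp [h1, h2, h3]⟩
    refine ⟨a + 1, by omega, hab, Or.inr ⟨rfl, hno _ (by omega) hab⟩, E_split a _ b ?_⟩
    intro u v huv hau hvb
    have h2 := hO _ _ huv
    by_cases hu : u = a
    · subst hu
      by_cases hv : v = b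
      · exact Or.inr (Or.inr ⟨rfl, hv⟩)
      · exact absurd huv (hno v h2 (by omega))
    · omega

/-- Surplus of the interval `[a, b]`. -/
def D (S : Finset (ℕ × ℕ)) (a b : ℕ) : ℤ := 2 * ((b : ℤ) - a) - E S a b

/-- The estimate that is proved for intervals. -/
def Q (S : Finset (ℕ × ℕ)) (K j : ℤ) (a b : ℕ) : Prop :=
  ∃ c : ℤ, 0 ≤ c ∧ (b : ℤ) - a + j ≤ K * D S a b + (2 * K - 1) * c ∧ c * K + 1 ≤ D S a b

/-- The estimate for intervals with a gap. -/
def PG (S : Finset (ℕ × ℕ)) (K : ℤ) (a b : ℕ) : Prop :=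
  ∃ c : ℤ, 0 ≤ c ∧ (b : ℤ) - a + 2 * K ≤ 1 + K * D S a b + (2 * K - 1) * c ∧
    c * K + 2 ≤ D S a b

/-- No triangle directly below the pair. -/
def NoTri (S : Finset (ℕ × ℕ)) (a b : ℕ) : Prop := ∀ y, (a, y) ∈ S → (y, b) ∉ S

/-- Edge chains with the total number of edges below them. -/
inductive Chn (S : Finset (ℕ × ℕ)) (R : ℕ → ℕ → Prop) : ℕ → ℕ → ℕ → ℤ → Prop
  | nil (a : ℕ) : Chn S R a a 0 0
  | cons {a x b m : ℕ} {s : ℤ} : (a, x) ∈ S → R a x → Chn S R x b m s →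
      Chn S R a b (m + 1) (E S a x + s)

variable {S : Finset (ℕ × ℕ)} {R R' : ℕ → ℕ → Prop}

lemma Chn.mc {a b m : ℕ} {s : ℤ} (h : Chn S R a b m s) : MC S a b m := by
  induction h with
  | nil a => exact MC.nil a
  | cons h1 _ _ ih => exact MC.cons h1 ih

lemma Chn.imp (hi : ∀ x y, (x, y) ∈ S → R x y → R' x y) {a b m : ℕ} {s : ℤ}
    (h : Chn S R a b m s) : Chn S R' a b m s := by
  induction h with
  | nil a => exact Chn.nil a
  | cons h1 h2 _ ih => exact Chn.cons h1 (hi _ _ h1 h2) ih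

lemma Chn.bdd (hO : Ord S) {a b m : ℕ} {s : ℤ} (h : Chn S R a b m s) :
    Chn S (fun x y => R x y ∧ y - x + m ≤ b - a + 1) a b m s := by
  induction h with
  | nil a => exact Chn.nil a
  | @cons a x b m s h1 h2 h3 ih =>
    have h4 := h3.mc.le hO
    have h5 := hO _ _ h1
    refine Chn.cons h1 ⟨h2, by omega⟩ (ih.imp ?_)
    rintro y z - ⟨h6, h7⟩
    exact ⟨h6, by omega⟩

lemma Chn.sum {K j : ℤ} {a b m : ℕ} {s : ℤ} (h : Chn S (Q S K j) a b m s) :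
    ∃ c : ℤ, 0 ≤ c ∧ (b : ℤ) - a + m * j ≤ K * (2 * ((b : ℤ) - a) - s) + (2 * K - 1) * c ∧
      c * K + m ≤ 2 * ((b : ℤ) - a) - s := by
  induction h with
  | nil a => exact ⟨0, le_rfl, by simp, by simp⟩
  | cons h1 h2 _ ih =>
    obtain ⟨c, hc, h3, h4⟩ := ih
    obtain ⟨c', hc', h5, h6⟩ := h2
    unfold D at h5 h6
    refine ⟨c + c', by omega, ?_, ?_⟩ <;> push_cast <;> linarith

lemma Chn.refine (hO : Ord S) (hN : NC S) {a b m : ℕ} {s : ℤ} (h : Chn S R a b m s) :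
    Chn S (NoTri S) a b m s ∨
      ∃ s', Chn S (fun _ _ => True) a b (m + 1) s' ∧ s ≤ s' + 1 := by
  induction h with
  | nil a => exact Or.inl (Chn.nil a)
  | @cons a x b m s h1 h2 h3 ih =>
    by_cases ht : NoTri S a x
    · rcases ih with ih | ⟨s', h4, h5⟩
      · exact Or.inl (Chn.cons h1 ht ih)
      · exact Or.inr ⟨_, Chn.cons h1 trivial h4, by linarith⟩
    · right
      unfold NoTri at ht
      push Not at ht
      obtain ⟨y, hy1, hy2⟩ := ht
      refine ⟨_, Chn.cons hy1 trivial (Chn.cons hy2 trivial (h3.imp fun _ _ _ _ => trivial)), ?_⟩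
      have := E_split (S := S) a y x (by
        intro u v huv h4 h5
        have := hN _ _ _ _ hy1 huv
        have := hN _ _ _ _ huv hy2
        have := hO _ _ huv
        have := hO _ _ hy1
        have := hO _ _ hy2
        omega)
      simp only [h1, if_true] at this
      linarith

lemma grow (hO : Ord S) (hN : NC S) {K : ℕ} (hC : CF S (K + 2)) {a b : ℕ} (hab : (a, b) ∈ S)
    (r : ℤ) : ∀ d m : ℕ, m + d = K → ∀ s, Chn S (fun _ _ => True) a b m s → E S a b ≤ s + m - r →
      ∃ m' s', m ≤ m' ∧ m' ≤ K ∧ Chn S (NoTri S) a b m' s' ∧ E S a b ≤ s' + m' - r := by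
  intro d
  induction d with
  | zero =>
    intro m hm s h hE
    rcases h.refine hO hN with h1 | ⟨s', h1, -⟩
    · exact ⟨m, s, le_rfl, by omega, h1, hE⟩
    · exfalso
      apply hC a b hab
      have := h1.mc
      rwa [show m + 1 = K + 2 - 1 by omega] at this
  | succ d ih =>
    intro m hm s h hE
    rcases h.refine hO hN with h1 | ⟨s', h1, h2⟩
    · exact ⟨m, s, le_rfl, by omega, h1, hE⟩
    · obtain ⟨m', s'', h3, h4⟩ := ih (m + 1) (by omega) s' h1 (by push_cast; linarith)
      exact ⟨m', s'', by omega, h4⟩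

lemma Q_of_le {K j j' : ℤ} (h : j' ≤ j) {a b : ℕ} (hq : Q S K j a b) : Q S K j' a b := by
  obtain ⟨c, h1, h2, h3⟩ := hq
  exact ⟨c, h1, by linarith, h3⟩

lemma Q_add {K : ℤ} (hK : 1 ≤ K) {a x b : ℕ} (h1 : Q S K 0 a x) (h2 : Q S K 0 x b)
    (hE : E S a b ≤ E S a x + E S x b) : Q S K 0 a b := by
  obtain ⟨c, hc, h3, h4⟩ := h1
  obtain ⟨c', hc', h5, h6⟩ := h2
  have hD : D S a x + D S x b ≤ D S a b := by unfold D; linarith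
  refine ⟨c + c', by omega, ?_, ?_⟩
  · nlinarith
  · linarith

lemma PG_add {K : ℤ} (hK : 1 ≤ K) {a x b : ℕ} (h1 : PG S K a x) (h2 : Q S K 0 x b)
    (hE : E S a b ≤ E S a x + E S x b) : PG S K a b := by
  obtain ⟨c, hc, h3, h4⟩ := h1
  obtain ⟨c', hc', h5, h6⟩ := h2
  have hD : D S a x + D S x b ≤ D S a b := by unfold D; linarith
  refine ⟨c + c', by omega, ?_, ?_⟩
  · nlinarith
  · linarith

lemma PG_add' {K : ℤ} (hK : 1 ≤ K) {a x b : ℕ} (h1 : Q S K 0 a x) (h2 : PG S K x b)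
    (hE : E S a b ≤ E S a x + E S x b) : PG S K a b := by
  obtain ⟨c, hc, h3, h4⟩ := h1
  obtain ⟨c', hc', h5, h6⟩ := h2
  have hD : D S a x + D S x b ≤ D S a b := by unfold D; linarith
  refine ⟨c + c', by omega, ?_, ?_⟩
  · nlinarith
  · linarith

lemma PG_unit (hO : Ord S) {K : ℤ} (hK : 1 ≤ K) (a : ℕ) (h : (a, a + 1) ∉ S) :
    PG S K a (a + 1) := by
  have := E_unit hO a
  simp only [h, if_false] at this
  have hD : 2 ≤ D S a (a + 1) := by unfold D; push_cast; linarith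
  refine ⟨0, le_rfl, ?_, by linarith⟩
  push_cast; nlinarith

/-- A gap below an edge. -/
lemma PG_top {K : ℤ} (hK : 1 ≤ K) {a x b : ℕ}
    (h : (PG S K a x ∧ Q S K 0 x b) ∨ (Q S K 0 a x ∧ PG S K x b))
    (hE : E S a b ≤ E S a x + E S x b + 1) : Q S K (K - 1) a b := by
  rcases h with ⟨⟨c, hc, h3, h4⟩, ⟨c', hc', h5, h6⟩⟩ | ⟨⟨c, hc, h3, h4⟩, ⟨c', hc', h5, h6⟩⟩
  all_goals
    have hD : D S a x + D S x b - 1 ≤ D S a b := by unfold D; linarith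
    refine ⟨c + c', by omega, ?_, by linarith⟩
    nlinarith

lemma chain_or_gap (hO : Ord S) (hN : NC S) {K : ℤ} (hK : 1 ≤ K) (L : ℕ)
    (ih : ∀ a b, a < b → b - a < L → Q S K 0 a b) :
    ∀ d a b, a < b → b - a = d → d < L →
      (∃ m s, 1 ≤ m ∧ Chn S (fun _ _ => True) a b m s ∧ E S a b ≤ s) ∨ PG S K a b := by
  intro d
  induction d using Nat.strong_induction_on with
  | _ d ihd =>
    intro a b hab hd hL
    by_cases he : (a, b) ∈ S
    · left
      exact ⟨1, _, le_rfl, Chn.cons he trivial (Chn.nil b), by simp⟩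
    · rcases Nat.lt_or_ge (a + 1) b with h | h
      · obtain ⟨x, h1, h2, h3, h4⟩ := exists_split hO hN h
        simp only [he, if_false, add_zero] at h4
        rcases h3 with h3 | ⟨rfl, h3⟩
        · rcases ihd (b - x) (by omega) x b h2 rfl (by omega) with ⟨m, s, h5, h6, h7⟩ | h5
          · left
            exact ⟨m + 1, _, by omega, Chn.cons h3 trivial h6, by linarith⟩
          · right
            exact PG_add' hK (ih a x h1 (by omega)) h5 h4
        · right
          exact PG_add hK (PG_unit hO hK a h3) (ih _ b h2 (by omega)) h4
      · right
        obtain rfl : b = a + 1 := by omega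
        exact PG_unit hO hK a he

theorem main_upper (hO : Ord S) (hN : NC S) {K : ℕ} (hK : 1 ≤ K) (hC : CF S (K + 2)) :
    ∀ L a b, a < b → b - a = L → Q S K 0 a b ∧
      ((a, b) ∈ S → NoTri S a b → Q S K (K - 1) a b) := by
  have hK' : (1 : ℤ) ≤ K := by exact_mod_cast hK
  intro L
  induction L using Nat.strong_induction_on with
  | _ L ihL =>
    intro a b hab hL
    have ih1 : ∀ a b, a < b → b - a < L → Q S K 0 a b := fun a b h1 h2 =>
      (ihL (b - a) h2 a b h1 rfl).1
    have ih2 : ∀ a b, (a, b) ∈ S → b - a < L → NoTri S a b → Q S K (K - 1) a b :=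
      fun a b h1 h2 h3 => (ihL (b - a) h2 a b (hO _ _ h1) rfl).2 h1 h3
    by_cases he : (a, b) ∈ S
    swap
    · refine ⟨?_, fun h => absurd h he⟩
      rcases Nat.lt_or_ge (a + 1) b with h | h
      · obtain ⟨x, h1, h2, h3, h4⟩ := exists_split hO hN h
        simp only [he, if_false, add_zero] at h4
        exact Q_add hK' (ih1 a x h1 (by omega)) (ih1 x b h2 (by omega)) h4
      · obtain rfl : b = a + 1 := by omega
        obtain ⟨c, h1, h2, h3⟩ := PG_unit hO hK' a he
        exact ⟨c, h1, by linarith, by linarith⟩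
    rcases Nat.lt_or_ge (a + 1) b with h | h
    swap
    · obtain rfl : b = a + 1 := by omega
      have hq : Q S K (K - 1) a (a + 1) := by
        have := E_unit hO a
        simp only [he, if_true] at this
        have hD : 1 ≤ D S a (a + 1) := by unfold D; push_cast; linarith
        refine ⟨0, le_rfl, ?_, by linarith⟩
        push_cast; nlinarith
      exact ⟨Q_of_le (by linarith) hq, fun _ _ => hq⟩
    obtain ⟨x, h1, h2, h3, h4⟩ := exists_split hO hN h
    simp only [he, if_true] at h4
    rcases h3 with h3 | ⟨rfl, h3⟩
    swap
    · have hq := PG_top hK' (Or.inl ⟨PG_unit hO hK' a h3, ih1 _ b h2 (by omega)⟩) h4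
      exact ⟨Q_of_le (by linarith) hq, fun _ _ => hq⟩
    rcases chain_or_gap hO hN hK' L ih1 (b - x) x b h2 rfl (by omega) with ⟨m, s, h5, h6, h7⟩ | h5
    swap
    · have hq := PG_top hK' (Or.inr ⟨ih1 a x h1 (by omega), h5⟩) h4
      exact ⟨Q_of_le (by linarith) hq, fun _ _ => hq⟩
    -- the face below the edge is closed
    have hch := Chn.cons h3 trivial h6
    set s0 := E S a x + s
    have hE : E S a b ≤ s0 + 1 := by simp only [s0]; linarith
    have hne : m + 1 ≠ K + 1 := by
      intro h8
      apply hC a b he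
      have := hch.mc
      rwa [h8] at this
    rcases Nat.lt_or_ge K (m + 1) with hbig | hsmall
    · -- big face
      have hq : Q S K (K - 1) a b := by
        have h8 := (hch.bdd hO).imp (R' := Q S K 0) (by
          rintro y z hy ⟨-, hz⟩
          exact ih1 y z (hO _ _ hy) (by omega))
        obtain ⟨c, hc, h9, h10⟩ := h8.sum
        have hm : (K : ℤ) + 2 ≤ m + 1 := by exact_mod_cast (by omega : K + 2 ≤ m + 1)
        have hD : 2 * ((b : ℤ) - a) - s0 - 1 ≤ D S a b := by unfold D; linarith
        push_cast at h9 h10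
        refine ⟨c + 1, by omega, ?_, by nlinarith⟩
        nlinarith
      exact ⟨Q_of_le (by linarith) hq, fun _ _ => hq⟩
    · -- small face
      have hfin : ∀ r : ℤ, r = 1 ∨ r = 2 → E S a b ≤ s0 + (m + 1 : ℕ) - r →
          Q S K ((r - 1) * (K - 1)) a b := by
        intro r hr hEr
        obtain ⟨m', s', g1, g2, g3, g4⟩ :=
          grow hO hN hC he r (K - (m + 1)) (m + 1) (by omega) s0 hch hEr
        have h8 := (g3.bdd hO).imp (R' := Q S K (K - 1)) (by
          rintro y z hy ⟨hz', hz⟩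
          exact ih2 y z hy (by omega) hz')
        obtain ⟨c, hc, h9, h10⟩ := h8.sum
        have hD : 2 * ((b : ℤ) - a) - s' - (m' - r) ≤ D S a b := by unfold D; linarith
        have g2' : (m' : ℤ) ≤ K := by exact_mod_cast g2
        refine ⟨c, hc, ?_, ?_⟩
        · rcases hr with rfl | rfl <;> nlinarith
        · rcases hr with rfl | rfl <;> linarith
      refine ⟨?_, ?_⟩
      · have := hfin 1 (Or.inl rfl) (by
          push_cast
          have : (1 : ℤ) ≤ m := by exact_mod_cast h5
          linarith)
        simpa using this
      · intro _ hnt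
        have hm2 : 2 ≤ m := by
          by_contra hlt
          obtain rfl : m = 1 := by omega
          obtain ⟨g, g0, gm, gg⟩ := h6.mc.fn
          have := gg 0 (by omega)
          simp only [g0, zero_add, gm] at this
          exact hnt x h3 this
        have := hfin 2 (Or.inr rfl) (by
          push_cast
          have : (2 : ℤ) ≤ m := by exact_mod_cast hm2
          linarith)
        simpa using this

end OPT
namespace OPT

/-- There is a cycle-free configuration on `[a, b]` with `e` edges, all of whose monotone
chains from `a` to `b` have lengths satisfying `P`. -/
def Cfg (k a b e : ℕ) (P : ℕ → Prop) : Prop :=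
  ∃ S : Finset (ℕ × ℕ), Ord S ∧ (∀ u v, (u, v) ∈ S → a ≤ u ∧ v ≤ b) ∧ NC S ∧ CF S k ∧
    S.card = e ∧ ∀ l, MC S a b l → P l

lemma Cfg.imp {k a b e : ℕ} {P P' : ℕ → Prop} (h : Cfg k a b e P) (hi : ∀ l, P l → P' l) :
    Cfg k a b e P' := by
  obtain ⟨S, h1, h2, h3, h4, h5, h6⟩ := h
  exact ⟨S, h1, h2, h3, h4, h5, fun l hl => hi l (h6 l hl)⟩

lemma MC_left {S1 S2 : Finset (ℕ × ℕ)} (hO : Ord (S1 ∪ S2)) {b : ℕ}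
    (h2 : ∀ u v, (u, v) ∈ S2 → b ≤ u) {u v l : ℕ} (h : MC (S1 ∪ S2) u v l) (hv : v ≤ b) :
    MC S1 u v l := by
  induction h with
  | nil a => exact MC.nil a
  | cons h3 h4 ih =>
    rcases Finset.mem_union.1 h3 with h5 | h5
    · exact MC.cons h5 (ih hv)
    · have := h4.le hO
      have := hO _ _ h3
      have := h2 _ _ h5
      omega

lemma MC_right {S1 S2 : Finset (ℕ × ℕ)} (hO : Ord (S1 ∪ S2)) {b : ℕ}
    (h1 : ∀ u v, (u, v) ∈ S1 → v ≤ b) {u v l : ℕ} (h : MC (S1 ∪ S2) u v l) (hu : b ≤ u) :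
    MC S2 u v l := by
  induction h with
  | nil a => exact MC.nil a
  | cons h3 h4 ih =>
    have := hO _ _ h3
    rcases Finset.mem_union.1 h3 with h5 | h5
    · have := h1 _ _ h5
      omega
    · exact MC.cons h5 (ih (by omega))

lemma MC_mid {S1 S2 : Finset (ℕ × ℕ)} (hO : Ord (S1 ∪ S2)) {b : ℕ}
    (h1 : ∀ u v, (u, v) ∈ S1 → v ≤ b) (h2 : ∀ u v, (u, v) ∈ S2 → b ≤ u)
    {u v l : ℕ} (h : MC (S1 ∪ S2) u v l) (hu : u ≤ b) (hv : b ≤ v) :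
    ∃ i j, MC S1 u b i ∧ MC S2 b v j ∧ l = i + j := by
  induction h with
  | nil a =>
    obtain rfl : a = b := by omega
    exact ⟨0, 0, MC.nil _, MC.nil _, rfl⟩
  | @cons u x v m h3 h4 ih =>
    rcases Finset.mem_union.1 h3 with h5 | h5
    · obtain ⟨i, j, h6, h7, rfl⟩ := ih (h1 _ _ h5) hv
      exact ⟨i + 1, j, MC.cons h5 h6, h7, by omega⟩
    · have := h2 _ _ h5
      obtain rfl : u = b := by omega
      exact ⟨0, m + 1, MC.nil _, MC_right hO h1 (MC.cons h3 h4) le_rfl, by omega⟩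

lemma Cfg.concat {k a b c e1 e2 : ℕ} {P1 P2 P : ℕ → Prop} (hab : a ≤ b) (hbc : b ≤ c)
    (h1 : Cfg k a b e1 P1) (h2 : Cfg k b c e2 P2) (hP : ∀ i j, P1 i → P2 j → P (i + j)) :
    Cfg k a c (e1 + e2) P := by
  classical
  obtain ⟨S1, o1, b1, n1, c1, d1, p1⟩ := h1
  obtain ⟨S2, o2, b2, n2, c2, d2, p2⟩ := h2
  have hO : Ord (S1 ∪ S2) := by
    intro u v h
    rcases Finset.mem_union.1 h with h | h
    · exact o1 _ _ h
    · exact o2 _ _ h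
  refine ⟨S1 ∪ S2, hO, ?_, ?_, ?_, ?_, ?_⟩
  · intro u v h
    rcases Finset.mem_union.1 h with h | h
    · have := b1 _ _ h; omega
    · have := b2 _ _ h; omega
  · intro u v u' v' h h'
    rcases Finset.mem_union.1 h with h | h <;> rcases Finset.mem_union.1 h' with h' | h'
    · exact n1 _ _ _ _ h h'
    · have := b1 _ _ h; have := b2 _ _ h'; omega
    · have := b2 _ _ h; have := b1 _ _ h'; have := o1 _ _ h'; omega
    · exact n2 _ _ _ _ h h'
  · intro u v h hm
    rcases Finset.mem_union.1 h with h | h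
    · exact c1 _ _ h (MC_left hO (fun u v h => (b2 u v h).1) hm (b1 _ _ h).2)
    · exact c2 _ _ h (MC_right hO (fun u v h => (b1 u v h).2) hm (b2 _ _ h).1)
  · rw [Finset.card_union_of_disjoint, d1, d2]
    rw [Finset.disjoint_left]
    rintro ⟨u, v⟩ h h'
    have := b1 _ _ h; have := b2 _ _ h'; have := o1 _ _ h; omega
  · intro l hl
    obtain ⟨i, j, hi, hj, rfl⟩ :=
      MC_mid hO (fun u v h => (b1 u v h).2) (fun u v h => (b2 u v h).1) hl hab hbc
    exact hP i j (p1 i hi) (p2 j hj)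

lemma MC_insert {S : Finset (ℕ × ℕ)} {a b : ℕ} (hab : a < b) (hO : Ord S)
    (hb : ∀ u v, (u, v) ∈ S → a ≤ u ∧ v ≤ b) {u v l : ℕ} (h : MC (insert (a, b) S) u v l) :
    MC S u v l ∨ (l = 1 ∧ u = a ∧ v = b) := by
  induction h with
  | nil u => exact Or.inl (MC.nil u)
  | @cons u x v m h1 h2 ih =>
    rcases Finset.mem_insert.1 h1 with h3 | h3
    · simp only [Prod.mk.injEq] at h3
      obtain ⟨rfl, rfl⟩ := h3
      cases h2 with
      | nil => exact Or.inr ⟨rfl, rfl, rfl⟩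
      | @cons _ y _ _ h4 _ =>
        exfalso
        rcases Finset.mem_insert.1 h4 with h5 | h5
        · simp only [Prod.mk.injEq] at h5; omega
        · have := hb _ _ h5; have := hO _ _ h5; omega
    · rcases ih with ih | ⟨-, rfl, -⟩
      · exact Or.inl (MC.cons h3 ih)
      · have := hb _ _ h3; have := hO _ _ h3; omega

lemma Cfg.top {k a b e : ℕ} {P : ℕ → Prop} (hk : 3 ≤ k) (hab : a < b) (h : Cfg k a b e P)
    (h1 : ¬ P 1) (h2 : ¬ P (k - 1)) : Cfg k a b (e + 1) (fun l => l = 1 ∨ P l) := by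
  classical
  obtain ⟨S, o, bd, n, c, d, p⟩ := h
  have hnot : (a, b) ∉ S := fun h => h1 (p 1 (MC.cons h (MC.nil b)))
  refine ⟨insert (a, b) S, ?_, ?_, ?_, ?_, ?_, ?_⟩
  · intro u v h
    rcases Finset.mem_insert.1 h with h | h
    · simp only [Prod.mk.injEq] at h; omega
    · exact o _ _ h
  · intro u v h
    rcases Finset.mem_insert.1 h with h | h
    · simp only [Prod.mk.injEq] at h; omega
    · exact bd _ _ h
  · intro u v u' v' h h'
    rcases Finset.mem_insert.1 h with h | h <;> rcases Finset.mem_insert.1 h' with h' | h'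
    · simp only [Prod.mk.injEq] at h h'; omega
    · simp only [Prod.mk.injEq] at h; have := bd _ _ h'; omega
    · simp only [Prod.mk.injEq] at h'; have := bd _ _ h; omega
    · exact n _ _ _ _ h h'
  · intro u v h hm
    rcases MC_insert hab o bd hm with hm2 | hm2
    · rcases Finset.mem_insert.1 h with h | h
      · simp only [Prod.mk.injEq] at h
        obtain ⟨rfl, rfl⟩ := h
        exact h2 (p _ hm2)
      · exact c _ _ h hm2
    · omega
  · rw [Finset.card_insert_of_notMem hnot, d]
  · intro l hl
    rcases MC_insert hab o bd hl with hm | hm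
    · exact Or.inr (p _ hm)
    · exact Or.inl hm.1

lemma Cfg.empty (k a b : ℕ) : Cfg k a b 0 (fun l => a = b ∧ l = 0) := by
  refine ⟨∅, ?_, ?_, ?_, ?_, rfl, ?_⟩
  · intro u v h; simp at h
  · intro u v h; simp at h
  · intro u v _ _ h; simp at h
  · intro u v h; simp at h
  · intro l hl
    cases hl with
    | nil => exact ⟨rfl, rfl⟩
    | cons h _ => simp at h

lemma Cfg.edge {k : ℕ} (hk : 3 ≤ k) (a : ℕ) : Cfg k a (a + 1) 1 (fun l => l = 1) := by
  have := (Cfg.empty k a (a + 1)).top hk (by omega) (by omega) (by omega)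
  exact this.imp (fun l hl => by omega)

lemma Cfg.topgrow {k a b e r : ℕ} (hk : 3 ≤ k) (hab : a < b)
    (h : Cfg k a b e (fun l => 1 ≤ l ∧ (l ≤ r ∨ k ≤ l))) (d : ℕ) (hr : r + d ≤ k - 2) :
    Cfg k a (b + d) (e + 2 * d) (fun l => 1 ≤ l ∧ (l ≤ r + d ∨ k ≤ l)) := by
  induction d with
  | zero => exact h
  | succ d ih =>
    have h1 := (ih (by omega)).concat (by omega) (by omega) (Cfg.edge hk (b + d))
      (P := fun l => 2 ≤ l ∧ (l ≤ r + d + 1 ∨ k + 1 ≤ l)) (by intro i j hi hj; omega)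
    have h2 := h1.top hk (by omega) (by omega) (by omega)
    exact h2.imp (fun l hl => by omega)

lemma Cfg.fan {k : ℕ} (hk : 3 ≤ k) (a r : ℕ) (h1 : 1 ≤ r) (h2 : r ≤ k - 2) :
    Cfg k a (a + r) (2 * r - 1) (fun l => 1 ≤ l ∧ (l ≤ r ∨ k ≤ l)) := by
  have := Cfg.topgrow (r := 1) hk (by omega)
    ((Cfg.edge hk a).imp (P' := fun l => 1 ≤ l ∧ (l ≤ 1 ∨ k ≤ l)) (fun l hl => by omega))
    (r - 1) (by omega)
  rw [show a + 1 + (r - 1) = a + r by omega, show 1 + 2 * (r - 1) = 2 * r - 1 by omega,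
    show 1 + (r - 1) = r by omega] at this
  exact this

lemma split_sum {K j1 j2 M : ℕ} (h1 : j1 + j2 ≤ M) (h2 : M ≤ (j1 + j2) * K) (hK : 1 ≤ K) :
    ∃ M1 M2, M = M1 + M2 ∧ j1 ≤ M1 ∧ M1 ≤ j1 * K ∧ j2 ≤ M2 ∧ M2 ≤ j2 * K := by
  have e1 : j1 ≤ j1 * K := Nat.le_mul_of_pos_right _ hK
  have e2 : j2 ≤ j2 * K := Nat.le_mul_of_pos_right _ hK
  rw [Nat.add_mul] at h2
  generalize j1 * K = x at *
  generalize j2 * K = y at *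
  rcases Nat.lt_or_ge (j1 + y) M with h | h
  · exact ⟨M - y, y, by omega, by omega, by omega, by omega, by omega⟩
  · exact ⟨j1, M - j1, by omega, by omega, by omega, by omega, by omega⟩

lemma Cfg.chain {k : ℕ} (hk : 3 ≤ k) (j : ℕ) : ∀ a M, j ≤ M → M ≤ j * (k - 2) →
    Cfg k a (a + M) (2 * M - j) (fun l => j ≤ l) := by
  induction j with
  | zero =>
    intro a M h1 h2
    obtain rfl : M = 0 := by omega
    exact (Cfg.empty k a a).imp (fun l _ => by omega)
  | succ j ih =>
    intro a M h1 h2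
    obtain ⟨M1, M2, rfl, h3, h4, h5, h6⟩ := split_sum h1 h2 (by omega)
    have h := (ih a M1 h3 h4).concat (by omega) (by omega)
      (Cfg.fan hk (a + M1) M2 h5 (by simpa using h6)) (P := fun l => j + 1 ≤ l)
      (by intro i j hi hj; omega)
    rw [show 2 * M1 - j + (2 * M2 - 1) = 2 * (M1 + M2) - (j + 1) by omega,
      Nat.add_assoc] at h
    exact h

lemma Cfg.closed {k : ℕ} (hk : 3 ≤ k) (t : ℕ) : ∀ a M, t * k + 1 ≤ M →
    M ≤ (t * k + 1) * (k - 2) →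
    Cfg k a (a + M - t) (2 * M - (t * k + 1)) (fun l => 1 ≤ l ∧ (l ≤ k - 2 ∨ k ≤ l)) := by
  induction t with
  | zero =>
    intro a M h1 h2
    simp only [Nat.zero_mul, Nat.zero_add, Nat.one_mul, Nat.sub_zero] at *
    exact (Cfg.fan hk a M h1 h2).imp (fun l hl => by omega)
  | succ t ih =>
    intro a M h1 h2
    have e : (t + 1) * k + 1 = (t * k + 1) + ((k - 1) + 1) := by rw [Nat.add_mul]; omega
    rw [e] at h1 h2 ⊢
    obtain ⟨M1, M', rfl, h3, h4, h5, h6⟩ := split_sum h1 h2 (by omega)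
    obtain ⟨M2, r, rfl, h7, h8, h9, h10⟩ := split_sum h5 h6 (by omega)
    have ht : t ≤ t * k := Nat.le_mul_of_pos_right _ (by omega)
    have g1 := (ih a M1 h3 h4).concat (by omega) (by omega)
      (Cfg.chain hk (k - 1) (a + M1 - t) M2 h7 h8) (P := fun l => k ≤ l)
      (by intro i j hi hj; omega)
    have g2 := g1.top hk (by omega) (by omega) (by omega)
    have g3 := Cfg.topgrow (r := 1) hk (by omega)
      (g2.imp (P' := fun l => 1 ≤ l ∧ (l ≤ 1 ∨ k ≤ l)) (fun l hl => by omega)) (r - 1) (by omega)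
    rw [show a + M1 - t + M2 + (r - 1) = a + (M1 + (M2 + r)) - (t + 1) by omega] at g3
    generalize t * k = x at *
    rw [show 2 * M1 - (x + 1) + (2 * M2 - (k - 1)) + 1 + 2 * (r - 1) =
      2 * (M1 + (M2 + r)) - (x + 1 + (k - 1 + 1)) by omega] at g3
    exact g3.imp (fun l hl => by omega)

lemma Cfg.final {k : ℕ} (hk : 3 ≤ k) (t m M : ℕ) (htm : t * k + 1 ≤ m) (h1 : m ≤ M)
    (h2 : M ≤ m * (k - 2)) : Cfg k 0 (M - t) (2 * M - m) (fun _ => True) := by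
  obtain ⟨j, rfl⟩ := Nat.exists_eq_add_of_le htm
  obtain ⟨M1, M2, rfl, h3, h4, h5, h6⟩ := split_sum h1 h2 (by omega)
  have ht : t ≤ t * k := Nat.le_mul_of_pos_right _ (by omega)
  have g := (Cfg.closed hk t 0 M1 h3 h4).concat (by omega) (by omega)
    (Cfg.chain hk j (0 + M1 - t) M2 h5 h6) (P := fun _ => True) (fun _ _ _ _ => trivial)
  generalize t * k = x at *
  rw [show 0 + M1 - t + M2 = M1 + M2 - t by omega,
    show 2 * M1 - (x + 1) + (2 * M2 - j) = 2 * (M1 + M2) - (x + 1 + j) by omega] at g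
  exact g

end OPT
namespace OPT

/-- Arithmetic description of `lam`: `lam` is the least integer with
`k (n - 2) ≤ lam (k (k - 2) - 1)`. -/
lemma lam_spec (n k : ℕ) (hk : 3 ≤ k) (hn : k ≤ n) (lam : ℕ)
    (hlam : lam = (k * n - 2 * k - 1) / (k ^ 2 - 2 * k - 1) + 1) :
    ((lam : ℤ) - 1) * (k * (k - 2) - 1) ≤ k * ((n : ℤ) - 2) - 1 ∧
      k * ((n : ℤ) - 2) ≤ lam * (k * (k - 2) - 1) := by
  have hkn : 2 * k + 1 ≤ k * n := by nlinarith
  have hkk : 2 * k + 1 < k ^ 2 := by nlinarith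
  set A := k * n - 2 * k - 1 with hA
  set B := k ^ 2 - 2 * k - 1 with hB
  have hB0 : 0 < B := by omega
  have eA : (A : ℤ) = k * ((n : ℤ) - 2) - 1 := by
    have : A + 2 * k + 1 = k * n := by omega
    zify at this; linarith
  have eB : (B : ℤ) = k * (k - 2) - 1 := by
    have : B + 2 * k + 1 = k ^ 2 := by omega
    zify at this; linarith
  have h1 := Nat.div_mul_le_self A B
  have h2 := Nat.lt_mul_div_succ A hB0
  rw [← eA, ← eB, hlam]
  zify at h1 h2
  push_cast
  constructor
  · linarith
  · linarith

lemma arith0 {K q n c D : ℤ} (hK : 1 ≤ K)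
    (hs : ((K + 2) * q - 1) * ((K + 2) * K - 1) ≤ (K + 2) * (n - 2) - 1)
    (h6 : n - 1 - 0 + 0 ≤ K * D + (2 * K - 1) * c) (h7 : c * K + 1 ≤ D) : K * q + 1 ≤ D := by
  by_contra hcon
  have hD : D ≤ K * q := by omega
  have hcq : c ≤ q - 1 := by
    by_contra hh
    have : q * K ≤ c * K := mul_le_mul_of_nonneg_right (by omega) (by omega)
    linarith
  have e1 : K * D ≤ K * (K * q) := mul_le_mul_of_nonneg_left hD (by omega)
  have e2 : (2 * K - 1) * c ≤ (2 * K - 1) * (q - 1) := mul_le_mul_of_nonneg_left hcq (by omega)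
  have e3 : (K + 2) * (n - 1) ≤ (K + 2) * (K * (K * q) + (2 * K - 1) * (q - 1)) :=
    mul_le_mul_of_nonneg_left (by linarith) (by omega)
  have e4 : 0 ≤ K * K := by positivity
  linarith

lemma arith1 {K q r n c D : ℤ} (hK : 1 ≤ K) (hr : r ≤ K + 1)
    (hs : ((K + 2) * q + r - 1) * ((K + 2) * (K + 2 - 2) - 1) ≤ (K + 2) * (n - 2) - 1)
    (h6 : n - 1 - 0 + 0 ≤ K * D + (2 * K - 1) * c) (h7 : c * K + 1 ≤ D) : K * q + r ≤ D := by
  by_contra hcon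
  have hD : D ≤ K * q + r - 1 := by omega
  have hcq : c ≤ q := by
    by_contra hh
    have : (q + 1) * K ≤ c * K := mul_le_mul_of_nonneg_right (by omega) (by omega)
    linarith
  have e1 : K * D ≤ K * (K * q + r - 1) := mul_le_mul_of_nonneg_left hD (by omega)
  have e2 : (2 * K - 1) * c ≤ (2 * K - 1) * q := mul_le_mul_of_nonneg_left hcq (by omega)
  have e3 : (K + 2) * (n - 1) ≤ (K + 2) * (K * (K * q + r - 1) + (2 * K - 1) * q) :=
    mul_le_mul_of_nonneg_left (by linarith) (by omega)
  linarith

end OPT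

theorem exOP_cycle (n k : ℕ) (hk : 3 ≤ k) (hn : k ≤ n)
    (lam : ℕ) (hlam : lam = (k * n - 2 * k - 1) / (k ^ 2 - 2 * k - 1) + 1) :
    (exOP n (SimpleGraph.cycleGraph k) : ℤ) =
      if k ∣ lam then 2 * (n : ℤ) - (lam : ℤ) + 2 * ((lam / k : ℕ) : ℤ) - 3
      else 2 * (n : ℤ) - (lam : ℤ) + 2 * ((lam / k : ℕ) : ℤ) - 2 := by
  obtain ⟨hs1, hs2⟩ := OPT.lam_spec n k hk hn lam hlam
  have hlam1 : 1 ≤ lam := by rw [hlam]; exact Nat.le_add_left 1 _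
  clear hlam
  set q := lam / k with hq
  obtain ⟨r, hr⟩ : ∃ r, r = lam % k := ⟨_, rfl⟩
  have hqr : k * q + r = lam := by rw [hr, hq]; exact Nat.div_add_mod lam k
  have hrk : r < k := by rw [hr]; exact Nat.mod_lt _ (by omega)
  have hdvd : k ∣ lam ↔ r = 0 := by rw [hr]; exact Nat.dvd_iff_mod_eq_zero
  -- the number of regions
  obtain ⟨m, hm⟩ : ∃ m, m = if r = 0 then lam + 1 else lam := ⟨_, rfl⟩
  have hgoal : (if k ∣ lam then 2 * (n : ℤ) - (lam : ℤ) + 2 * (q : ℤ) - 3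
      else 2 * (n : ℤ) - (lam : ℤ) + 2 * (q : ℤ) - 2) = 2 * ((n : ℤ) - 1 + q) - m := by
    by_cases h : r = 0
    · rw [if_pos (hdvd.2 h), hm, if_pos h]; push_cast; ring
    · rw [if_neg (fun h' => h (hdvd.1 h')), hm, if_neg h]; ring
  rw [hgoal]
  obtain ⟨K, rfl⟩ : ∃ K, k = K + 2 := ⟨k - 2, by omega⟩
  have hK : 1 ≤ K := by omega
  have hK' : (1 : ℤ) ≤ K := by exact_mod_cast hK
  have hqr' : ((K : ℤ) + 2) * q + r = lam := by exact_mod_cast hqr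
  have hrk' : (r : ℤ) ≤ K + 1 := by exact_mod_cast (by omega : r ≤ K + 1)
  have hr0 : (0 : ℤ) ≤ r := by positivity
  have hq0 : (0 : ℤ) ≤ q := by positivity
  have hn' : (K : ℤ) + 2 ≤ n := by exact_mod_cast hn
  push_cast at hs1 hs2
  rw [← hqr'] at hs1 hs2
  have hmq : q * (K + 2) + 1 ≤ m := by
    rw [hm]; split_ifs with h
    · rw [← hqr]; linarith [Nat.mul_comm q (K + 2)]
    · rw [← hqr]; have := Nat.mul_comm q (K + 2); omega
  have hm' : (m : ℤ) = if r = 0 then (lam : ℤ) + 1 else lam := by rw [hm]; split_ifs <;> simp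
  rw [← hqr'] at hm'
  have hmle : m ≤ n - 1 + q := by
    suffices h : (m : ℤ) ≤ (n : ℤ) - 1 + q by omega
    rw [hm']
    by_contra hcon
    push Not at hcon
    have hx : (((K : ℤ) + 2) * q + r - 1) * (K + 1) ≤ (K + 2) * ((n : ℤ) - 2) - 1 := by
      have h0 : (0 : ℤ) ≤ ((K : ℤ) + 2) * q + r - 1 := by
        rw [hqr']; linarith [(by exact_mod_cast hlam1 : (1 : ℤ) ≤ lam)]
      refine le_trans (mul_le_mul_of_nonneg_left ?_ h0) hs1
      nlinarith
    split_ifs at hcon with h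
    · subst h
      push_cast at *
      nlinarith
    · nlinarith
  have hMle : n - 1 + q ≤ m * K := by
    suffices h : (n : ℤ) - 1 + q ≤ (m : ℤ) * K by
      have : ((n - 1 + q : ℕ) : ℤ) ≤ ((m * K : ℕ) : ℤ) := by push_cast; omega
      exact_mod_cast this
    rw [hm']
    by_contra hcon
    push Not at hcon
    split_ifs at hcon with h
    · subst h
      push_cast at *
      nlinarith
    · have : (1 : ℤ) ≤ r := by omega
      nlinarith
  have hgreat : IsGreatest {m : ℕ | ∃ G : SimpleGraph (Fin n), IsOuterplanar G ∧
      ¬ ContainsCopy (SimpleGraph.cycleGraph (K + 2)) G ∧ m = G.edgeSet.ncard}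
      (2 * (n - 1 + q) - m) := by
    constructor
    · obtain ⟨S, h1, h2, h3, h4, h5, -⟩ := OPT.Cfg.final hk q m (n - 1 + q) hmq hmle
        (by simpa using hMle)
      obtain ⟨G, g1, g2, g3⟩ := OPT.down (n := n) hk S h1
        (fun u v h => by have := h2 u v h; omega) h3 h4
      exact ⟨G, g1, g2, by rw [← g3, h5]⟩
    · rintro e ⟨G, g1, g2, rfl⟩
      obtain ⟨S, h1, h2, h3, h4, h5⟩ := OPT.up hk G g1 g2
      obtain ⟨c, hc, h6, h7⟩ := (OPT.main_upper h1 h3 hK h4 (n - 1) 0 (n - 1) (by omega)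
        (by omega)).1
      have hE : OPT.E S 0 (n - 1) = S.card := by
        unfold OPT.E
        rw [Finset.filter_true_of_mem]
        rintro ⟨u, v⟩ h
        have := h2 u v h
        simp only
        omega
      have hn1 : ((n - 1 : ℕ) : ℤ) = n - 1 := by omega
      rw [h5]
      obtain ⟨D, hD⟩ : ∃ D, D = OPT.D S 0 (n - 1) := ⟨_, rfl⟩
      rw [← hD] at h6 h7
      have hD' : D = 2 * ((n : ℤ) - 1) - S.card := by
        rw [hD, OPT.D, hE, hn1]; push_cast; ring
      suffices h : (m : ℤ) - 2 * q ≤ D by omega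
      rw [hn1] at h6
      push_cast at h6
      clear hD hE hn1 hgoal
      rw [hm']
      split_ifs with h
      · subst h
        have := OPT.arith0 hK' (by simpa using hs1) h6 h7
        push_cast; linarith
      · have := OPT.arith1 hK' hrk' hs1 h6 h7
        linarith
  have : exOP n (SimpleGraph.cycleGraph (K + 2)) = 2 * (n - 1 + q) - m := hgreat.csSup_eq
  rw [this]
  omega
end

section
/- For all integers n and k with n ≥ k ≥ 3, there exists an outerplanar graph on n vertices containing no cycle of length k whose number of edges is at least f(n,k), where λ = ⌊(kn − 2k − 1)/(k² − 2k − 1)⌋ + 1, and f(n,k) = 2n − λ + 2⌊λ/k⌋ − 3 if k divides λ, and f(n,k) = 2n − λ + 2⌊λ/k⌋ − 2 otherwise. -/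
/-- Increasing path with `l` edges. -/
inductive IncPath (E : Finset (ℕ × ℕ)) (a : ℕ) : ℕ → ℕ → Prop
  | nil : IncPath E a a 0
  | cons {b c l : ℕ} : IncPath E a b l → (b, c) ∈ E → IncPath E a c (l + 1)

structure GoodSet (k : ℕ) (E : Finset (ℕ × ℕ)) (N : ℕ) (e : ℤ) (d : ℕ) : Prop where
  lt : ∀ a b, (a, b) ∈ E → a < b
  le : ∀ a b, (a, b) ∈ E → b ≤ N
  nc : ∀ a b c d, (a, b) ∈ E → (c, d) ∈ E → ¬ (a < c ∧ c < b ∧ b < d)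
  cf : ∀ a b, (a, b) ∈ E → ¬ IncPath E a b (k - 1)
  card : e ≤ E.card
  dist : ∀ l, IncPath E 0 N l → d ≤ l

def HasGood (k N : ℕ) (e : ℤ) (d : ℕ) : Prop := ∃ E, GoodSet k E N e d

lemma IncPath.add_le {E : Finset (ℕ × ℕ)} (h : ∀ a b, (a, b) ∈ E → a < b) {a b l : ℕ}
    (p : IncPath E a b l) : a + l ≤ b := by
  induction p with
  | nil => simp
  | cons _ hb ih => have := h _ _ hb; omega

lemma HasGood.base (k : ℕ) : HasGood k 0 0 0 :=
  ⟨∅, by constructor <;> simp⟩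

/-- fan apex edges from `a` to `N+1..N+t` -/
def apexSet (a N t : ℕ) : Finset (ℕ × ℕ) := (Finset.range t).image fun i => (a, N + i)

def pathSet (N t : ℕ) : Finset (ℕ × ℕ) := (Finset.range t).image fun i => (N + i, N + i + 1)

lemma mem_apexSet {a N t x y : ℕ} : (x, y) ∈ apexSet a N t ↔ x = a ∧ N ≤ y ∧ y < N + t := by
  simp only [apexSet, Finset.mem_image, Finset.mem_range, Prod.mk.injEq]
  constructor
  · rintro ⟨i, hi, rfl, rfl⟩; omega
  · rintro ⟨rfl, h1, h2⟩; exact ⟨y - N, by omega, rfl, by omega⟩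

lemma mem_pathSet {N t x y : ℕ} : (x, y) ∈ pathSet N t ↔ y = x + 1 ∧ N ≤ x ∧ x < N + t := by
  simp only [pathSet, Finset.mem_image, Finset.mem_range, Prod.mk.injEq]
  constructor
  · rintro ⟨i, hi, rfl, rfl⟩; omega
  · rintro ⟨rfl, h1, h2⟩; exact ⟨x - N, by omega, by omega, by omega⟩

lemma card_apexSet (a N t : ℕ) : (apexSet a N t).card = t := by
  rw [apexSet, Finset.card_image_of_injective, Finset.card_range]
  intro i j h; simpa using h

lemma card_pathSet (N t : ℕ) : (pathSet N t).card = t := by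
  rw [pathSet, Finset.card_image_of_injective, Finset.card_range]
  intro i j h; simpa using h

lemma HasGood.pendant {k N d : ℕ} {e : ℤ} (h : HasGood k N e d) {t : ℕ} (ht : 1 ≤ t)
    (htk : t + 2 ≤ k) : HasGood k (N + t) (e + 2 * t - 1) (d + 1) := by
  obtain ⟨E, hE⟩ := h
  have hmem : ∀ a b, (a, b) ∈ E ∪ (apexSet N (N + 1) t ∪ pathSet (N + 1) (t - 1)) ↔
      (a, b) ∈ E ∨ ((a = N ∧ N + 1 ≤ b ∧ b < N + 1 + t) ∨
        (b = a + 1 ∧ N + 1 ≤ a ∧ a < N + 1 + (t - 1))) := by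
    intro a b
    rw [Finset.mem_union, Finset.mem_union, mem_apexSet, mem_pathSet]
  have hlt : ∀ a b, (a, b) ∈ E ∪ (apexSet N (N + 1) t ∪ pathSet (N + 1) (t - 1)) → a < b := by
    intro a b hab
    rcases (hmem a b).1 hab with h | h
    · exact hE.lt _ _ h
    · omega
  have hold : ∀ a b l, IncPath (E ∪ (apexSet N (N + 1) t ∪ pathSet (N + 1) (t - 1))) a b l →
      b ≤ N → IncPath E a b l := by
    intro a b l p
    induction p with
    | nil => intro _; exact .nil
    | cons _ hb ih =>
      intro hc
      have h1 := hlt _ _ hb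
      rcases (hmem _ _).1 hb with h | h
      · exact (ih (by omega)).cons h
      · omega
  have hthru : ∀ b l, IncPath (E ∪ (apexSet N (N + 1) t ∪ pathSet (N + 1) (t - 1))) 0 b l →
      N < b → d + 1 ≤ l := by
    intro b l p
    induction p with
    | nil => intro h; omega
    | @cons b c l p hb ih =>
      intro hc
      rcases (hmem _ _).1 hb with h | h
      · have := hE.le _ _ h; omega
      · by_cases hbN : b = N
        · subst hbN
          have := hE.dist _ (hold _ _ _ p le_rfl)
          omega
        · have := ih (by omega)
          omega
  refine ⟨_, ⟨hlt, ?_, ?_, ?_, ?_, ?_⟩⟩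
  · intro a b hab
    rcases (hmem a b).1 hab with h | h
    · have := hE.le _ _ h; omega
    · omega
  · intro a b c d hab hcd
    rcases (hmem _ _).1 hab with h | h <;> rcases (hmem _ _).1 hcd with h' | h'
    · exact hE.nc _ _ _ _ h h'
    · have := hE.le _ _ h; omega
    · have := hE.le _ _ h'; omega
    · omega
  · intro a b hab p
    rcases (hmem a b).1 hab with h | h
    · exact hE.cf _ _ h (hold _ _ _ p (hE.le _ _ h))
    · have := p.add_le hlt
      omega
  · rw [Finset.card_union_of_disjoint, Finset.card_union_of_disjoint, card_apexSet, card_pathSet]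
    · have := hE.card
      push_cast [ht]
      omega
    · rw [Finset.disjoint_left]
      rintro ⟨x, y⟩ h1 h2
      rw [mem_apexSet] at h1
      rw [mem_pathSet] at h2
      omega
    · rw [Finset.disjoint_left]
      rintro ⟨x, y⟩ h1 h2
      have := hE.le _ _ h1
      rw [Finset.mem_union, mem_apexSet, mem_pathSet] at h2
      omega
  · intro l p
    exact hthru _ _ p (by omega)

lemma HasGood.top {k N d : ℕ} {e : ℤ} (h : HasGood k N e d) (hd : k ≤ d) {j : ℕ}
    (hk : j + 3 ≤ k) : HasGood k (N + j) (e + 2 * j + 1) 1 := by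
  obtain ⟨E, hE⟩ := h
  have hN : 0 < N := by
    rcases Nat.eq_zero_or_pos N with h | h
    · subst h
      have := hE.dist _ .nil
      omega
    · exact h
  have h0N : (0, N) ∉ E := fun h => by
    have := hE.dist _ (IncPath.nil.cons h)
    omega
  have hmem : ∀ a b, (a, b) ∈ E ∪ (apexSet 0 N (j + 1) ∪ pathSet N j) ↔
      (a, b) ∈ E ∨ ((a = 0 ∧ N ≤ b ∧ b < N + (j + 1)) ∨
        (b = a + 1 ∧ N ≤ a ∧ a < N + j)) := by
    intro a b
    rw [Finset.mem_union, Finset.mem_union, mem_apexSet, mem_pathSet]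
  have hlt : ∀ a b, (a, b) ∈ E ∪ (apexSet 0 N (j + 1) ∪ pathSet N j) → a < b := by
    intro a b hab
    rcases (hmem a b).1 hab with h | h
    · exact hE.lt _ _ h
    · omega
  have hold : ∀ a b l, IncPath (E ∪ (apexSet 0 N (j + 1) ∪ pathSet N j)) a b l →
      b ≤ N → IncPath E a b l ∨ (a = 0 ∧ b = N) := by
    intro a b l p
    induction p with
    | nil => intro _; exact .inl .nil
    | cons p hb ih =>
      intro hc
      have h1 := hlt _ _ hb
      have h2 := p.add_le hlt
      rcases (hmem _ _).1 hb with h | h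
      · rcases ih (by omega) with h3 | h3
        · exact .inl (h3.cons h)
        · omega
      · right; omega
  have hthru : ∀ b l, IncPath (E ∪ (apexSet 0 N (j + 1) ∪ pathSet N j)) 0 b l →
      N ≤ b → k ≤ l ∨ l ≤ b - N + 1 := by
    intro b l p
    induction p with
    | nil => intro h; omega
    | @cons b c l p hb ih =>
      intro hc
      have h2 := p.add_le hlt
      have h1 := hlt _ _ hb
      rcases (hmem _ _).1 hb with h | h
      · have h3 := hE.le _ _ h
        obtain rfl : c = N := by omega
        rcases hold _ _ _ p (by omega) with h4 | h4
        · have := hE.dist _ (h4.cons h)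
          omega
        · omega
      · rcases h with h | h
        · omega
        · have := ih (by omega)
          omega
  refine ⟨_, ⟨hlt, ?_, ?_, ?_, ?_, ?_⟩⟩
  · intro a b hab
    rcases (hmem a b).1 hab with h | h
    · have := hE.le _ _ h; omega
    · omega
  · intro a b c d hab hcd
    rcases (hmem _ _).1 hab with h | h <;> rcases (hmem _ _).1 hcd with h' | h'
    · exact hE.nc _ _ _ _ h h'
    · have := hE.le _ _ h; omega
    · have := hE.le _ _ h'; omega
    · omega
  · intro a b hab p
    rcases (hmem a b).1 hab with h | h
    · rcases hold _ _ _ p (hE.le _ _ h) with h1 | ⟨rfl, rfl⟩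
      · exact hE.cf _ _ h h1
      · exact h0N h
    · rcases h with ⟨rfl, h1, h2⟩ | h
      · have := hthru _ _ p h1
        omega
      · have := p.add_le hlt
        omega
  · rw [Finset.card_union_of_disjoint, Finset.card_union_of_disjoint, card_apexSet, card_pathSet]
    · have := hE.card
      push_cast
      omega
    · rw [Finset.disjoint_left]
      rintro ⟨x, y⟩ h1 h2
      rw [mem_apexSet] at h1
      rw [mem_pathSet] at h2
      omega
    · rw [Finset.disjoint_left]
      rintro ⟨x, y⟩ h1 h2
      have h3 := hE.le _ _ h1
      have h4 := hE.lt _ _ h1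
      rw [Finset.mem_union, mem_apexSet, mem_pathSet] at h2
      have h5 : x = 0 ∧ y = N := by omega
      rw [h5.1, h5.2] at h1
      exact h0N h1
  · intro l p
    rcases Nat.eq_zero_or_pos l with rfl | hl
    · generalize hM : N + j = M at p
      cases p
      omega
    · exact hl

lemma HasGood.mono {k N d d' : ℕ} {e e' : ℤ} (h : HasGood k N e d) (he : e' ≤ e) (hd : d' ≤ d) :
    HasGood k N e' d' := by
  obtain ⟨E, hE⟩ := h
  exact ⟨E, hE.lt, hE.le, hE.nc, hE.cf, he.trans hE.card, fun l p => hd.trans (hE.dist l p)⟩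

/-- `p` pendant blobs with `r` vertices in total. -/
lemma HasGood.pendants {c N d : ℕ} {e : ℤ} (h : HasGood (c + 3) N e d) (p r : ℕ) (hpr : p ≤ r)
    (hr : r ≤ p * (c + 1)) : HasGood (c + 3) (N + r) (e + 2 * r - p) (d + p) := by
  induction p generalizing r with
  | zero =>
    obtain rfl : r = 0 := by omega
    simpa using h
  | succ p ih =>
    rw [Nat.add_mul, one_mul] at hr
    have hp : p ≤ p * (c + 1) := Nat.le_mul_of_pos_right _ (by omega)
    obtain ⟨t, r', h1, h2, h3, h4, h5⟩ : ∃ t r', 1 ≤ t ∧ t ≤ c + 1 ∧ r = r' + t ∧ p ≤ r' ∧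
        r' ≤ p * (c + 1) := by
      by_cases hc : r ≤ p + (c + 1)
      · exact ⟨r - p, p, by omega, by omega, by omega, le_rfl, hp⟩
      · exact ⟨c + 1, r - (c + 1), by omega, le_rfl, by omega, by omega, by omega⟩
    have := (ih r' h4 h5).pendant h1 (by omega)
    subst h3
    rw [← add_assoc, ← add_assoc]
    refine this.mono ?_ le_rfl
    push_cast
    linarith

lemma HasGood.pendants' {c N d : ℕ} {e : ℤ} (h : HasGood (c + 3) N e d) (p r : ℕ)
    (hr : r ≤ p * (c + 1)) : HasGood (c + 3) (N + r) (e + 2 * r - p) 0 := by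
  by_cases hpr : p ≤ r
  · exact (h.pendants p r hpr hr).mono le_rfl (by omega)
  · refine (h.pendants r r le_rfl (Nat.le_mul_of_pos_right _ (by omega))).mono ?_ (by omega)
    omega

/-- An ear. -/
lemma HasGood.ear {c N : ℕ} {e : ℤ} (h : HasGood (c + 3) N e 1) (r : ℕ)
    (h1 : c + 2 ≤ r) (h2 : r ≤ (c + 2) * (c + 1)) :
    HasGood (c + 3) (N + (r + c)) (e + 2 * (r + c + 1) - (c + 3)) 1 := by
  have := ((h.pendants (c + 2) r h1 h2).top (by omega) (j := c) (by omega))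
  rw [← add_assoc]
  refine this.mono ?_ le_rfl
  push_cast
  linarith

lemma HasGood.ears {c N : ℕ} {e : ℤ} (h : HasGood (c + 3) N e 1) (q : ℕ) :
    HasGood (c + 3) (N + q * (c ^ 2 + 4 * c + 2))
      (e + q * (2 * (c ^ 2 + 4 * c + 2) + 2 - (c + 3))) 1 := by
  induction q with
  | zero => simpa using h
  | succ q ih =>
    have := ih.ear ((c + 2) * (c + 1)) (by nlinarith) le_rfl
    have e1 : N + (q + 1) * (c ^ 2 + 4 * c + 2) =
      N + q * (c ^ 2 + 4 * c + 2) + ((c + 2) * (c + 1) + c) := by ring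
    rw [e1]
    refine this.mono (le_of_eq ?_) le_rfl
    push_cast
    ring

lemma HasGood.start (c t : ℕ) (h : t ≤ c) : HasGood (c + 3) (t + 1) (2 * t + 1) 1 := by
  have := (HasGood.base (c + 3)).pendant (t := t + 1) (by omega) (by omega)
  rw [zero_add] at this
  refine this.mono ?_ le_rfl
  push_cast
  linarith

lemma incPath_of_cycle {E : Finset (ℕ × ℕ)} (hlt : ∀ a b, (a, b) ∈ E → a < b)
    (nc : ∀ a b c d, (a, b) ∈ E → (c, d) ∈ E → ¬ (a < c ∧ c < b ∧ b < d))
    (k : ℕ) (hk : 3 ≤ k) (h : ℕ → ℕ)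
    (inj : ∀ i j, i < k → j < k → h i = h j → i = j)
    (hadj : ∀ i, i + 1 < k → (h i, h (i + 1)) ∈ E ∨ (h (i + 1), h i) ∈ E)
    (hlast : (h 0, h (k - 1)) ∈ E)
    (h0 : ∀ i, 0 < i → i < k → h 0 < h i) (h1 : h 1 < h (k - 1)) :
    IncPath E (h 0) (h (k - 1)) (k - 1) := by
  have key : ∀ i, i < k → (∀ j, i < j → j < k → h i < h j) ∧ IncPath E (h 0) (h i) i := by
    intro i
    induction i with
    | zero => exact fun _ => ⟨h0, .nil⟩
    | succ i ih =>
      intro hi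
      obtain ⟨ih1, ih2⟩ := ih (by omega)
      have hii := ih1 (i + 1) (by omega) hi
      have hE : (h i, h (i + 1)) ∈ E := by
        rcases hadj i hi with h | h
        · exact h
        · have := hlt _ _ h; omega
      refine ⟨?_, ih2.cons hE⟩
      have down : ∀ s, i + 1 < k - 1 - s → h (i + 1) < h (k - 1 - s) := by
        intro s
        induction s with
        | zero =>
          intro hs
          simp only [Nat.sub_zero] at hs ⊢
          rcases Nat.eq_zero_or_pos i with rfl | hi0
          · exact h1
          · by_contra hcon
            have hne : h (k - 1) ≠ h (i + 1) := fun heq => by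
              have := inj _ _ (by omega) (by omega) heq
              omega
            exact nc _ _ _ _ hlast hE
              ⟨h0 i hi0 (by omega), ih1 (k - 1) (by omega) (by omega), by omega⟩
        | succ s ihs =>
          intro hs
          have hprev := ihs (by omega)
          by_contra hcon
          have hne : h (k - 1 - (s + 1)) ≠ h (i + 1) := fun heq => by
            have := inj _ _ (by omega) (by omega) heq
            omega
          have hgt := ih1 (k - 1 - (s + 1)) (by omega) (by omega)
          have hstep := hadj (k - 1 - (s + 1)) (by omega)
          rw [show k - 1 - (s + 1) + 1 = k - 1 - s by omega] at hstep
          rcases hstep with hs' | hs'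
          · exact nc _ _ _ _ hE hs' ⟨hgt, by omega, hprev⟩
          · have := hlt _ _ hs'; omega
      intro j hj hjk
      have := down (k - 1 - j) (by omega)
      rwa [show k - 1 - (k - 1 - j) = j by omega] at this
  exact (key (k - 1) (by omega)).2

lemma exists_incPath_of_cycle {E : Finset (ℕ × ℕ)} (hlt : ∀ a b, (a, b) ∈ E → a < b)
    (nc : ∀ a b c d, (a, b) ∈ E → (c, d) ∈ E → ¬ (a < c ∧ c < b ∧ b < d))
    (k : ℕ) (hk : 3 ≤ k) (h : ℕ → ℕ)
    (inj : ∀ i j, i < k → j < k → h i = h j → i = j)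
    (hadj : ∀ i, (h i, h (i + 1)) ∈ E ∨ (h (i + 1), h i) ∈ E)
    (hper : h k = h 0) (h0 : ∀ i, 0 < i → i < k → h 0 < h i) :
    ∃ a b, (a, b) ∈ E ∧ IncPath E a b (k - 1) := by
  have hne : h 1 ≠ h (k - 1) := fun heq => by
    have := inj _ _ (by omega) (by omega) heq
    omega
  rcases lt_or_gt_of_ne hne with hl | hl
  · have hlast : (h 0, h (k - 1)) ∈ E := by
      have h2 := hadj (k - 1)
      rw [show k - 1 + 1 = k by omega, hper] at h2
      rcases h2 with h2 | h2
      · have := hlt _ _ h2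
        have := h0 (k - 1) (by omega) (by omega)
        omega
      · exact h2
    exact ⟨_, _, hlast, incPath_of_cycle hlt nc k hk h inj (fun i _ => hadj i) hlast h0 hl⟩
  · have hlast : (h 0, h 1) ∈ E := by
      have h3 := hadj 0
      rw [zero_add] at h3
      rcases h3 with h2 | h2
      · exact h2
      · have := hlt _ _ h2
        have := h0 1 (by omega) (by omega)
        omega
    have e1 : k - (k - 1) = 1 := by omega
    have hinj : ∀ i, i < k → ∃ i', i' < k ∧ h (k - i) = h i' ∧
        ((i = 0 ∧ i' = 0) ∨ (0 < i ∧ i' = k - i)) := by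
      intro i hi
      rcases Nat.eq_zero_or_pos i with rfl | hi0
      · exact ⟨0, by omega, by simpa using hper, by omega⟩
      · exact ⟨k - i, by omega, rfl, by omega⟩
    have hp := incPath_of_cycle hlt nc k hk (fun i => h (k - i)) ?_ ?_ ?_ ?_ ?_
    · simp only [Nat.sub_zero, hper, e1] at hp
      exact ⟨_, _, hlast, hp⟩
    · intro i j hi hj hij
      obtain ⟨i', a1, a2, a3⟩ := hinj i hi
      obtain ⟨j', b1, b2, b3⟩ := hinj j hj
      have := inj i' j' a1 b1 (by rw [← a2, ← b2]; exact hij)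
      omega
    · intro i hi
      have := hadj (k - (i + 1))
      rw [show k - (i + 1) + 1 = k - i by omega] at this
      exact this.symm
    · simpa only [Nat.sub_zero, hper, e1] using hlast
    · intro i hi hik
      simp only [Nat.sub_zero, hper]
      exact h0 _ (by omega) (by omega)
    · simpa only [e1] using hl

lemma HasGood.graph {k N d : ℕ} {e : ℤ} (h : HasGood k N e d) (hk : 3 ≤ k) :
    ∃ G : SimpleGraph (Fin (N + 1)), IsOuterplanar G ∧
      ¬ ContainsCopy (SimpleGraph.cycleGraph k) G ∧ e ≤ (G.edgeSet.ncard : ℤ) := by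
  obtain ⟨E, hE⟩ := h
  let G : SimpleGraph (Fin (N + 1)) :=
    { Adj := fun x y => ((x : ℕ), (y : ℕ)) ∈ E ∨ ((y : ℕ), (x : ℕ)) ∈ E
      symm := ⟨fun x y h => h.symm⟩
      loopless := ⟨fun x h => by
        rcases h with h | h <;> exact absurd (hE.lt _ _ h) (lt_irrefl _)⟩ }
  have hG : ∀ x y, G.Adj x y ↔ ((x : ℕ), (y : ℕ)) ∈ E ∨ ((y : ℕ), (x : ℕ)) ∈ E :=
    fun x y => Iff.rfl
  refine ⟨G, ⟨fun x => ((x : ℕ) : ℤ), ?_, ?_⟩, ?_, ?_⟩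
  · intro x y hxy
    have : (x : ℕ) = y := Int.ofNat.inj hxy
    exact Fin.ext this
  · intro a b c d hab hcd hh
    have h3 : (a : ℕ) < c ∧ (c : ℕ) < b ∧ (b : ℕ) < d :=
      ⟨Int.ofNat_lt.1 hh.1, Int.ofNat_lt.1 hh.2.1, Int.ofNat_lt.1 hh.2.2⟩
    rcases (hG _ _).1 hab with h1 | h1
    · rcases (hG _ _).1 hcd with h2 | h2
      · exact hE.nc _ _ _ _ h1 h2 h3
      · have := hE.lt _ _ h2; omega
    · have := hE.lt _ _ h1; omega
  · rintro ⟨φ, hφ⟩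
    have hk0 : 0 < k := by omega
    have : NeZero k := ⟨by omega⟩
    obtain ⟨i0, hi0⟩ := Finite.exists_min (fun i : Fin k => ((φ i : Fin (N + 1)) : ℕ))
    let g : ℕ → Fin k := fun i => ⟨(i0 + i) % k, Nat.mod_lt _ hk0⟩
    have ginj : ∀ i j, i < k → j < k → g i = g j → i = j := by
      intro i j hi hj hij
      have h1 : (i0 + i) % k = (i0 + j) % k := congrArg Fin.val hij
      have h2 : i ≡ j [MOD k] := Nat.ModEq.add_left_cancel' (i0 : ℕ) h1
      exact Nat.ModEq.eq_of_lt_of_lt h2 hi hj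
    have g0 : g 0 = i0 := by
      apply Fin.ext
      simp [g, Nat.mod_eq_of_lt i0.2]
    have inj : ∀ i j, i < k → j < k → (φ (g i) : ℕ) = (φ (g j) : ℕ) → i = j :=
      fun i j hi hj hij => ginj i j hi hj (hφ (Fin.ext hij))
    have hex := exists_incPath_of_cycle hE.lt hE.nc k hk (fun i => (φ (g i) : ℕ))
      inj ?_ ?_ ?_
    · obtain ⟨a, b, hab, hp⟩ := hex
      exact hE.cf _ _ hab hp
    · intro i
      refine (hG _ _).1 (φ.map_rel ?_)
      rw [SimpleGraph.cycleGraph_adj']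
      right
      rw [Fin.sub_def]
      simp only [g]
      have h1 : (i0 + i) % k < k := Nat.mod_lt _ hk0
      have h2 : ((i0 : ℕ) + (i + 1)) % k = if (i0 + i) % k + 1 = k then 0 else (i0 + i) % k + 1 := by
        rw [← add_assoc, Nat.add_mod, Nat.mod_eq_of_lt (show 1 < k by omega)]
        split_ifs with h
        · rw [h, Nat.mod_self]
        · exact Nat.mod_eq_of_lt (by omega)
      rw [h2]
      split_ifs with h
      · rw [show k - (i0 + i) % k + 0 = 1 by omega]
        exact Nat.mod_eq_of_lt (by omega)
      · rw [show k - (i0 + i) % k + ((i0 + i) % k + 1) = 1 + k by omega, Nat.add_mod_right]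
        exact Nat.mod_eq_of_lt (by omega)
    · have : g k = g 0 := by
        apply Fin.ext
        simp [g]
      simp only [this]
    · intro i hi hik
      have h1 := hi0 (g i)
      rw [← g0] at h1
      refine lt_of_le_of_ne h1 fun heq => ?_
      have := inj _ _ hk0 hik heq
      omega
  · refine hE.card.trans ?_
    norm_cast
    rw [← Set.ncard_coe_finset]
    refine Set.ncard_le_ncard_of_injOn
      (fun p => s(Fin.ofNat (N + 1) p.1, Fin.ofNat (N + 1) p.2)) ?_ ?_ (Set.toFinite _)
    · rintro ⟨x, y⟩ hxy
      have hxy : (x, y) ∈ E := hxy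
      have h1 := hE.lt _ _ hxy
      have h2 := hE.le _ _ hxy
      rw [SimpleGraph.mem_edgeSet, hG]
      left
      simpa [Fin.ofNat, Nat.mod_eq_of_lt (show x < N + 1 by omega),
        Nat.mod_eq_of_lt (show y < N + 1 by omega)] using hxy
    · rintro ⟨x, y⟩ hxy ⟨z, w⟩ hzw heq
      have hxy : (x, y) ∈ E := hxy
      have hzw : (z, w) ∈ E := hzw
      have h1 := hE.lt _ _ hxy
      have h2 := hE.le _ _ hxy
      have h3 := hE.lt _ _ hzw
      have h4 := hE.le _ _ hzw
      have fo : ∀ u v, u ≤ N → v ≤ N → Fin.ofNat (N + 1) u = Fin.ofNat (N + 1) v → u = v := by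
        intro u v hu hv huv
        have := congrArg Fin.val huv
        simpa [Fin.ofNat, Nat.mod_eq_of_lt (show u < N + 1 by omega),
          Nat.mod_eq_of_lt (show v < N + 1 by omega)] using this
      rw [Sym2.eq_iff] at heq
      rcases heq with ⟨e1, e2⟩ | ⟨e1, e2⟩
      · exact Prod.ext (fo x z (by omega) (by omega) e1) (fo y w (by omega) (by omega) e2)
      · have := fo x w (by omega) (by omega) e1
        have := fo y z (by omega) (by omega) e2
        omega

theorem exists_outerplanar_cycleFree_many_edges (n k : ℕ) (hk : 3 ≤ k) (hn : k ≤ n)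
    (lam : ℕ) (hlam : lam = (k * n - 2 * k - 1) / (k ^ 2 - 2 * k - 1) + 1) :
    ∃ G : SimpleGraph (Fin n), IsOuterplanar G ∧ ¬ ContainsCopy (SimpleGraph.cycleGraph k) G ∧
      (if k ∣ lam then 2 * (n : ℤ) - (lam : ℤ) + 2 * ((lam / k : ℕ) : ℤ) - 3
       else 2 * (n : ℤ) - (lam : ℤ) + 2 * ((lam / k : ℕ) : ℤ) - 2) ≤ (G.edgeSet.ncard : ℤ) := by
  obtain ⟨c, rfl⟩ : ∃ c, k = c + 3 := ⟨k - 3, by omega⟩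
  obtain ⟨m, rfl⟩ : ∃ m, n = m + 1 + 1 := ⟨n - 2, by omega⟩
  have hm : 1 ≤ m := by omega
  set D := c ^ 2 + 4 * c + 2 with hD
  have hDpos : 0 < D := by omega
  have e1 : (c + 3) ^ 2 - 2 * (c + 3) - 1 = D := by
    have : (c + 3) ^ 2 = D + 2 * (c + 3) + 1 := by rw [hD]; ring
    omega
  have e2 : (c + 3) * (m + 1 + 1) - 2 * (c + 3) - 1 = (c + 3) * m - 1 := by
    have : (c + 3) * (m + 1 + 1) = (c + 3) * m + 2 * (c + 3) := by ring
    omega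
  rw [e1, e2] at hlam
  suffices H : ∃ d, HasGood (c + 3) (m + 1) (if (c + 3) ∣ lam then
      2 * ((m + 1 + 1 : ℕ) : ℤ) - (lam : ℤ) + 2 * ((lam / (c + 3) : ℕ) : ℤ) - 3
       else 2 * ((m + 1 + 1 : ℕ) : ℤ) - (lam : ℤ) + 2 * ((lam / (c + 3) : ℕ) : ℤ) - 2) d by
    obtain ⟨d, hd⟩ := H
    exact hd.graph hk
  obtain ⟨q, r, hr, hqr⟩ : ∃ q r, r < D ∧ m = q * D + r :=
    ⟨m / D, m % D, Nat.mod_lt _ hDpos, by rw [mul_comm]; exact (Nat.div_add_mod m D).symm⟩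
  -- characterise lam
  obtain ⟨mu, hmu⟩ : ∃ mu, lam = (c + 3) * q + mu ∧ (c + 3) * r ≤ mu * D ∧
      mu * D < (c + 3) * r + D := by
    have h1 : 1 ≤ (c + 3) * m := Nat.mul_pos (by omega) hm
    have h2 := Nat.div_add_mod ((c + 3) * m - 1) D
    have h3 := Nat.mod_lt ((c + 3) * m - 1) hDpos
    have h4 : (c + 3) * m = (c + 3) * q * D + (c + 3) * r := by rw [hqr]; ring
    set Q := ((c + 3) * m - 1) / D
    have h5 : D * Q + D = lam * D := by rw [hlam]; ring
    have h6 : (c + 3) * q ≤ lam := by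
      by_contra hcon
      have : (lam + 1) * D ≤ (c + 3) * q * D := Nat.mul_le_mul_right _ (by omega)
      rw [Nat.add_mul] at this
      omega
    obtain ⟨mu, hmu⟩ := Nat.exists_eq_add_of_le h6
    have h7 : lam * D = (c + 3) * q * D + mu * D := by rw [hmu]; ring
    exact ⟨mu, hmu, by omega, by omega⟩
  obtain ⟨hl, hmu1, hmu2⟩ := hmu
  have hmuk : mu ≤ c + 3 := by
    by_contra hcon
    have h1 : (c + 4) * D ≤ mu * D := Nat.mul_le_mul_right _ (by omega)
    have h2 : (c + 3) * r ≤ (c + 3) * D := Nat.mul_le_mul_left _ hr.le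
    have h3 : (c + 4) * D = (c + 3) * D + D := by ring
    omega
  clear hlam
  rcases Nat.eq_zero_or_pos r with rfl | hr0
  · obtain rfl : mu = 0 := by
      by_contra hcon
      have : D ≤ mu * D := Nat.le_mul_of_pos_left _ (by omega)
      omega
    have := (HasGood.start c 0 (by omega)).ears q
    rw [← hD] at this
    refine ⟨1, ?_⟩
    have hN : m + 1 = 0 + 1 + q * D := by omega
    rw [hN]
    refine this.mono (le_of_eq ?_) le_rfl
    rw [if_pos ⟨q, by omega⟩, hl]
    simp only [add_zero, Nat.mul_div_cancel_left q (show 0 < c + 3 by omega)]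
    push_cast [hD]
    ring
  have hmu0 : 1 ≤ mu := by
    by_contra hcon
    obtain rfl : mu = 0 := by omega
    have : 0 < (c + 3) * r := Nat.mul_pos (by omega) hr0
    omega
  rcases Nat.lt_or_ge mu (c + 3) with hlt | hge
  · -- pendants
    have hrm : r + 1 ≤ mu * (c + 1) := by
      have h1 : (c + 3) * r < (c + 3) * (mu * (c + 1)) := by
        have : (c + 3) * (mu * (c + 1)) = mu * D + mu := by rw [hD]; ring
        omega
      exact Nat.lt_of_mul_lt_mul_left h1
    obtain ⟨nu, rfl⟩ : ∃ nu, mu = nu + 1 := ⟨mu - 1, by omega⟩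
    rw [Nat.add_mul, one_mul] at hrm
    obtain ⟨r0, r1, h1, h2, h3⟩ : ∃ r0 r1, r = r0 + r1 ∧ r0 ≤ c ∧ r1 ≤ nu * (c + 1) :=
      ⟨min r c, r - min r c, by omega, by omega, by omega⟩
    have := ((HasGood.start c r0 h2).ears q).pendants' nu r1 h3
    rw [← hD] at this
    refine ⟨0, ?_⟩
    have hN : m + 1 = r0 + 1 + q * D + r1 := by omega
    have hdiv : lam / (c + 3) = q := by
      rw [hl, Nat.mul_add_div (by omega), Nat.div_eq_of_lt hlt, add_zero]
    have hnd : ¬ (c + 3) ∣ lam := by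
      rw [hl, Nat.dvd_add_right (Nat.dvd_mul_right _ _)]
      exact fun h => absurd (Nat.le_of_dvd (by omega) h) (by omega)
    rw [hdiv, if_neg hnd, hl, hN]
    refine this.mono (le_of_eq ?_) le_rfl
    push_cast [hD]
    ring
  · obtain rfl : mu = c + 3 := by omega
    have hrD : D ≤ r + c := by
      have h2 : (c + 3) * D < (c + 3) * (r + c + 1) := by
        have h3 : (c + 3) * (r + c + 1) = (c + 3) * r + D + 1 := by rw [hD]; ring
        have h4 : (c + 3) * D < (c + 3) * r + D := hmu2
        omega
      have := Nat.lt_of_mul_lt_mul_left h2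
      omega
    obtain ⟨r1, rfl⟩ : ∃ r1, r = r1 + c := by
      refine ⟨r - c, ?_⟩
      have : c ≤ r := by nlinarith
      omega
    have := ((HasGood.start c 0 (by omega)).ears q).ear r1 (by nlinarith) (by nlinarith)
    rw [← hD] at this
    refine ⟨1, ?_⟩
    have hN : m + 1 = 0 + 1 + q * D + (r1 + c) := by omega
    have hl' : lam = (c + 3) * (q + 1) := by rw [hl]; ring
    rw [if_pos ⟨q + 1, hl'⟩, hl', Nat.mul_div_cancel_left _ (show 0 < c + 3 by omega), hN]
    refine this.mono (le_of_eq ?_) le_rfl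
    push_cast [hD]
    ring
end

section
/- For all integers n and k with n ≥ k ≥ 4, the maximum number of edges in a connected outerplanar graph on n vertices that contains no path on k vertices equals 2n − ⌈(n − k + 1)/(⌊k/2⌋ − 1)⌉ − 4. -/
/-- The maximum number of edges of a connected `H`-free outerplanar graph on `n` vertices. -/
noncomputable def exOP' (n : ℕ) {W : Type*} (H : SimpleGraph W) : ℕ :=
  sSup {m : ℕ | ∃ G : SimpleGraph (Fin n),
    IsOuterplanar G ∧ G.Connected ∧ ¬ ContainsCopy H G ∧ m = G.edgeSet.ncard}

/-- The maximum number of edges of an `H`-free outerplanar graph on `n` vertices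
all of whose connected components have at most `k - 1` vertices. -/
noncomputable def exOP'' (n k : ℕ) {W : Type*} (H : SimpleGraph W) : ℕ :=
  sSup {m : ℕ | ∃ G : SimpleGraph (Fin n),
    IsOuterplanar G ∧ (∀ c : G.ConnectedComponent, c.supp.ncard ≤ k - 1) ∧
    ¬ ContainsCopy H G ∧ m = G.edgeSet.ncard}

namespace OPPath

open Finset

/-- Non-crossing labeling. -/
def NonCross {V : Type*} (G : SimpleGraph V) (f : V → ℤ) : Prop :=
  Function.Injective f ∧
    ∀ a b c d : V, G.Adj a b → G.Adj c d → ¬(f a < f c ∧ f c < f b ∧ f b < f d)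

/-- Cut-style connectivity of a finite vertex set. -/
def Conn {V : Type*} (G : SimpleGraph V) (S : Finset V) : Prop :=
  ∀ T : Set V, (∃ x ∈ S, x ∈ T) → (∃ x ∈ S, x ∉ T) →
    ∃ x ∈ S, ∃ y ∈ S, x ∈ T ∧ y ∉ T ∧ G.Adj x y

/-- A list is a path inside `S`. -/
def PathIn {V : Type*} (G : SimpleGraph V) (S : Finset V) (l : List V) : Prop :=
  l.Nodup ∧ l.IsChain G.Adj ∧ ∀ x ∈ l, x ∈ S

/-- `S` decomposes as `S1 ∪ S2` along the cut vertex `c`. -/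
def SplitAt {V : Type*} (G : SimpleGraph V) (S S1 S2 : Finset V) (c : V) : Prop :=
  (∀ x, x ∈ S ↔ x ∈ S1 ∨ x ∈ S2) ∧ (∀ x, (x ∈ S1 ∧ x ∈ S2) ↔ x = c) ∧
  (∃ x ∈ S1, x ≠ c) ∧ (∃ x ∈ S2, x ≠ c) ∧
  ∀ a ∈ S1, ∀ b ∈ S2, a ≠ c → b ≠ c → ¬ G.Adj a b

section
variable {V : Type*} {G : SimpleGraph V}

lemma SplitAt.symm {S S1 S2 : Finset V} {c : V} (h : SplitAt G S S1 S2 c) :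
    SplitAt G S S2 S1 c := by
  obtain ⟨h1, h2, h3, h4, h5⟩ := h
  refine ⟨fun x => by rw [h1, or_comm], fun x => by rw [← h2, and_comm], h4, h3, ?_⟩
  intro a ha b hb hac hbc hab
  exact h5 b hb a ha hbc hac hab.symm

lemma SplitAt.conn {S S1 S2 : Finset V} {c : V} (h : SplitAt G S S1 S2 c)
    (hS : Conn G S) : Conn G S1 := by
  obtain ⟨h1, h2, h3, h4, h5⟩ := h
  have hc := (h2 c).2 rfl
  intro T ⟨x, hx, hxT⟩ ⟨y, hy, hyT⟩
  by_cases hcT : c ∈ T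
  · obtain ⟨a, ha, b, hb, haT, hbT, hab⟩ := hS (T ∪ {z | z ∈ S2}) ⟨x, (h1 x).2 (Or.inl hx), Or.inl hxT⟩
      ⟨y, (h1 y).2 (Or.inl hy), by
        rintro (h | h)
        · exact hyT h
        · exact hyT (((h2 y).1 ⟨hy, h⟩) ▸ hcT)⟩
    simp only [Set.mem_union, Set.mem_ofPred_eq, not_or] at haT hbT
    have hb1 : b ∈ S1 := ((h1 b).1 hb).resolve_right hbT.2
    have hbc : b ≠ c := fun h => hbT.1 (h ▸ hcT)
    by_cases hac : a = c
    · subst hac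
      exact ⟨a, hc.1, b, hb1, hcT, hbT.1, hab⟩
    · have ha2 : a ∉ S2 := fun h => h5 b hb1 a h hbc hac hab.symm
      exact ⟨a, ((h1 a).1 ha).resolve_right ha2, b, hb1, haT.resolve_right ha2, hbT.1, hab⟩
  · obtain ⟨a, ha, b, hb, haT, hbT, hab⟩ := hS (T ∩ {z | z ∈ S1}) ⟨x, (h1 x).2 (Or.inl hx), hxT, hx⟩
      ⟨y, (h1 y).2 (Or.inl hy), fun h => hyT h.1⟩
    have hac : a ≠ c := fun h => hcT (h ▸ haT.1)
    have ha1 : a ∈ S1 := haT.2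
    have hb1 : b ∈ S1 := by
      by_contra hb1
      have hb2 := ((h1 b).1 hb).resolve_left hb1
      exact h5 a ha1 b hb2 hac (fun h => hb1 (h ▸ hc.1)) hab
    exact ⟨a, ha1, b, hb1, haT.1, fun h => hbT ⟨h, hb1⟩, hab⟩

lemma PathIn.reverse {S : Finset V} {l : List V} (h : PathIn G S l) : PathIn G S l.reverse := by
  obtain ⟨h1, h2, h3⟩ := h
  refine ⟨List.nodup_reverse.2 h1, ?_, by simpa using h3⟩
  rw [List.isChain_reverse]
  exact h2.imp fun a b h => h.symm

lemma PathIn.mono {S T : Finset V} {l : List V} (h : PathIn G S l) (hST : ∀ x ∈ S, x ∈ T) :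
    PathIn G T l := ⟨h.1, h.2.1, fun x hx => hST x (h.2.2 x hx)⟩

lemma SplitAt.glue {S S1 S2 : Finset V} {c : V} (h : SplitAt G S S1 S2 c) {p q : List V}
    (hp : PathIn G S1 (p ++ [c])) (hq : PathIn G S2 (c :: q)) : PathIn G S (p ++ c :: q) := by
  obtain ⟨h1, h2, h3, h4, h5⟩ := h
  obtain ⟨p1, p2, p3⟩ := hp
  obtain ⟨q1, q2, q3⟩ := hq
  refine ⟨?_, ?_, ?_⟩
  · rw [List.nodup_append] at p1 ⊢
    refine ⟨p1.1, q1, ?_⟩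
    rintro a ha b hb rfl
    have := (h2 a).1 ⟨p3 a (by simp [ha]), q3 a hb⟩
    exact p1.2.2 a ha c (by simp) this
  · rw [List.isChain_split]
    exact ⟨p2, q2⟩
  · intro x hx
    rw [h1]
    rw [List.mem_append] at hx
    rcases hx with hx | hx
    · exact Or.inl (p3 x (by simp [hx]))
    · exact Or.inr (q3 x hx)

lemma Conn.path {S : Finset V} (hS : Conn G S) {u c : V} (hu : u ∈ S) (hc : c ∈ S) :
    ∃ p : List V, PathIn G S (p ++ [c]) ∧ (p ++ [c]).head? = some u := by
  by_contra hcon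
  obtain ⟨x, hx, y, hy, hxT, hyT, hxy⟩ := hS
    {c | ∃ p : List V, PathIn G S (p ++ [c]) ∧ (p ++ [c]).head? = some u}
    ⟨u, hu, [], ⟨by simp, by simp, by simpa using hu⟩, by simp⟩ ⟨c, hc, hcon⟩
  apply hyT
  obtain ⟨p, ⟨p1, p2, p3⟩, p4⟩ := hxT
  by_cases hyp : y ∈ p ++ [x]
  · obtain ⟨s, t, hst⟩ := List.append_of_mem hyp
    rw [hst] at p1 p2 p3 p4
    refine ⟨s, ⟨?_, ?_, ?_⟩, ?_⟩
    · exact p1.sublist (by simp)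
    · exact (List.isChain_split.1 p2).1
    · intro z hz
      apply p3
      simp only [List.mem_append, List.mem_cons, List.not_mem_nil, or_false] at hz ⊢
      tauto
    · cases s <;> simpa using p4
  · refine ⟨p ++ [x], ⟨?_, ?_, ?_⟩, ?_⟩
    · rw [List.nodup_append]
      refine ⟨p1, by simp, ?_⟩
      rintro a ha b hb rfl
      simp only [List.mem_cons, List.not_mem_nil, or_false] at hb
      exact hyp (hb ▸ ha)
    · rw [List.append_assoc]
      simp only [List.singleton_append]
      rw [List.isChain_split]
      exact ⟨p2, by simpa using hxy⟩
    · intro z hz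
      rw [List.mem_append] at hz
      rcases hz with hz | hz
      · exact p3 z hz
      · simp at hz; exact hz ▸ hy
    · cases p <;> simpa using p4

lemma exists_split {S : Finset V} {f : V → ℤ} (hf : NonCross G f) (hS : Conn G S)
    {u w : V} (hu : u ∈ S) (hw : w ∈ S) (huw : u ≠ w)
    (hmin : ∀ z ∈ S, f u ≤ f z) (hmax : ∀ z ∈ S, f z ≤ f w) (hadj : ¬ G.Adj u w) :
    ∃ S1 S2 c, SplitAt G S S1 S2 c := by
  classical
  obtain ⟨x, hx, y, hy, hxT, hyT, hxy⟩ := hS {u} ⟨u, hu, rfl⟩ ⟨w, hw, fun h => huw h.symm⟩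
  obtain rfl : x = u := hxT
  obtain ⟨c, hc, hcmax⟩ := Finset.exists_max_image (S.filter (fun z => G.Adj x z)) f
    ⟨y, by simp [hy, hxy]⟩
  simp only [Finset.mem_filter] at hc hcmax
  have hcw : c ≠ w := fun h => hadj (h ▸ hc.2)
  have hxc : x ≠ c := hc.2.ne
  refine ⟨S.filter (fun z => f z ≤ f c), S.filter (fun z => f c ≤ f z), c, ?_, ?_, ?_, ?_, ?_⟩
  · intro z
    simp only [Finset.mem_filter]
    rcases le_total (f z) (f c) with h | h <;> tauto
  · intro z
    simp only [Finset.mem_filter]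
    constructor
    · rintro ⟨⟨_, h1⟩, _, h2⟩
      exact hf.1 (le_antisymm h1 h2)
    · rintro rfl
      exact ⟨⟨hc.1, le_rfl⟩, hc.1, le_rfl⟩
  · exact ⟨x, by simp [hx, hmin c hc.1], hxc⟩
  · exact ⟨w, by simp [hw, hmax c hc.1], hcw.symm⟩
  · intro a ha b hb hac hbc hab
    simp only [Finset.mem_filter] at ha hb
    have h1 : f a < f c := lt_of_le_of_ne ha.2 (fun h => hac (hf.1 h))
    have h2 : f c < f b := lt_of_le_of_ne hb.2 (fun h => hbc (hf.1 h).symm)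
    by_cases hax : a = x
    · subst hax
      have := hcmax b ⟨hb.1, hab⟩
      omega
    · have h3 : f x < f a := lt_of_le_of_ne (hmin a ha.1) (fun h => hax (hf.1 h).symm)
      exact hf.2 x c a b hc.2 hab ⟨h3, h1, h2⟩

/-- Rotating a non-crossing labeling so that labels below `t` move to the top. -/
lemma rotate [Finite V] {f : V → ℤ} (hf : NonCross G f) (t : ℤ) :
    ∃ g : V → ℤ, NonCross G g ∧ ∀ x y, g x < g y ↔
      ((t ≤ f x ∧ f y < t) ∨ ((t ≤ f x ↔ t ≤ f y) ∧ f x < f y)) := by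
  classical
  obtain ⟨M, hM⟩ := (Set.finite_range f).bddAbove
  obtain ⟨N, hN⟩ := (Set.finite_range f).bddBelow
  have hM' : ∀ x, f x ≤ M := fun x => hM ⟨x, rfl⟩
  have hN' : ∀ x, N ≤ f x := fun x => hN ⟨x, rfl⟩
  have key : ∀ x y, (if t ≤ f x then f x else f x + (M - N + 1)) <
      (if t ≤ f y then f y else f y + (M - N + 1)) ↔
      ((t ≤ f x ∧ f y < t) ∨ ((t ≤ f x ↔ t ≤ f y) ∧ f x < f y)) := by
    intro x y
    have := hM' x; have := hM' y; have := hN' x; have := hN' y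
    split_ifs <;> constructor <;> intro h <;> omega
  refine ⟨fun z => if t ≤ f z then f z else f z + (M - N + 1), ⟨?_, ?_⟩, key⟩
  · intro x y hxy
    apply hf.1
    have := hM' x; have := hM' y; have := hN' x; have := hN' y
    simp only at hxy
    split_ifs at hxy <;> omega
  · intro a b c d hab hcd h
    simp only [key] at h
    have e1 := hf.2 a b c d hab hcd
    have e2 := hf.2 b a d c hab.symm hcd.symm
    have e3 := hf.2 c d b a hcd hab.symm
    have e4 := hf.2 d c a b hcd.symm hab
    by_cases ha : t ≤ f a <;> by_cases hb : t ≤ f b <;> by_cases hc : t ≤ f c <;>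
      by_cases hd : t ≤ f d <;> simp [ha, hb, hc, hd] at h <;> omega

lemma consec_adj [Finite V] {S : Finset V} {f : V → ℤ} (hf : NonCross G f) (hS : Conn G S)
    (hns : ¬ ∃ S1 S2 c, SplitAt G S S1 S2 c)
    {x y : V} (hx : x ∈ S) (hy : y ∈ S) (hxy : f x < f y)
    (hno : ∀ z ∈ S, ¬ (f x < f z ∧ f z < f y)) : G.Adj x y := by
  by_contra hadj
  obtain ⟨g, hg, hgf⟩ := rotate hf (f y)
  apply hns
  refine exists_split hg hS hy hx (fun h => by simp [h] at hxy) ?_ ?_ (fun h => hadj h.symm)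
  · intro z hz
    by_contra h
    rw [not_le, hgf] at h
    have := hno z hz
    omega
  · intro z hz
    by_contra h
    rw [not_le, hgf] at h
    have := hno z hz
    omega

lemma ham_path [Finite V] {S : Finset V} {f : V → ℤ} (hf : NonCross G f) (hS : Conn G S)
    (hns : ¬ ∃ S1 S2 c, SplitAt G S S1 S2 c) {v : V} (hv : v ∈ S) :
    ∃ l, PathIn G S (v :: l) ∧ l.length + 1 = S.card := by
  classical
  obtain ⟨g, hg, hgf⟩ := rotate hf (f v)
  have hmin : ∀ z ∈ S, g v ≤ g z := by
    intro z hz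
    by_contra h
    rw [not_le, hgf] at h
    omega
  -- build up initial segments
  have key : ∀ T : Finset V, T.Nonempty → T ⊆ S → (∀ x ∈ T, ∀ y ∈ S, g y ≤ g x → y ∈ T) →
      ∃ l w, PathIn G T (l ++ [w]) ∧ (l ++ [w]).head? = some v ∧ l.length + 1 = T.card ∧
        ∀ z ∈ T, g z ≤ g w := by
    intro T
    induction hT : T.card generalizing T with
    | zero => intro h; simp [Finset.card_eq_zero.1 hT] at h
    | succ N ih =>
      intro hne hTS hdown
      obtain ⟨w, hw, hwmax⟩ := Finset.exists_max_image T g hne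
      by_cases hne' : (T.erase w).Nonempty
      · obtain ⟨l, w', hl, hhead, hlen, hw'⟩ := ih (T.erase w)
          (by rw [Finset.card_erase_of_mem hw, hT]; rfl) hne'
          (fun x hx => hTS (Finset.mem_of_mem_erase hx)) (by
            intro x hx y hy hyx
            have hxT := Finset.mem_of_mem_erase hx
            refine Finset.mem_erase.2 ⟨?_, hdown x hxT y hy hyx⟩
            rintro rfl
            have := hwmax x hxT
            exact (Finset.ne_of_mem_erase hx) (hg.1 (le_antisymm this hyx)))
        have hw'm : w' ∈ T.erase w := hl.2.2 w' (by simp)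
        have hw'T := Finset.mem_of_mem_erase hw'm
        have hlt : g w' < g w := lt_of_le_of_ne (hwmax w' hw'T)
          (fun h => Finset.ne_of_mem_erase hw'm (hg.1 h))
        have hadj : G.Adj w' w := by
          refine consec_adj hg hS hns (hTS hw'T) (hTS hw) hlt ?_
          rintro z hz ⟨h1, h2⟩
          have hzT := hdown w hw z hz h2.le
          have := hw' z (Finset.mem_erase.2 ⟨fun h => by simp [h] at h2, hzT⟩)
          omega
        refine ⟨l ++ [w'], w, ⟨?_, ?_, ?_⟩, ?_, ?_, hwmax⟩
        · rw [List.nodup_append]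
          refine ⟨hl.1, by simp, ?_⟩
          rintro a ha b hb rfl
          simp only [List.mem_cons, List.not_mem_nil, or_false] at hb
          exact Finset.ne_of_mem_erase (hl.2.2 a ha) hb
        · rw [List.append_assoc]
          simp only [List.singleton_append]
          rw [List.isChain_split]
          exact ⟨hl.2.1, by simpa using hadj⟩
        · intro z hz
          rw [List.mem_append] at hz
          rcases hz with hz | hz
          · exact Finset.mem_of_mem_erase (hl.2.2 z hz)
          · simp at hz; exact hz ▸ hw
        · cases l <;> simpa using hhead
        · simp [hlen]
      · rw [Finset.not_nonempty_iff_eq_empty] at hne'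
        have hTw : ∀ z ∈ T, z = w := by
          intro z hz
          by_contra h
          have : z ∈ T.erase w := Finset.mem_erase.2 ⟨h, hz⟩
          simp [hne'] at this
        have hvw : v = w := hTw v (hdown w hw v hv (hmin w (hTS hw)))
        refine ⟨[], w, ⟨by simp, by simp, by simpa using hw⟩, by simp [hvw], ?_, hwmax⟩
        have := Finset.card_erase_of_mem hw
        rw [hne', hT] at this
        simpa using this.symm
  obtain ⟨l, w, hl, hhead, hlen, -⟩ := key S ⟨v, hv⟩ subset_rfl (fun _ _ y hy _ => hy)
  cases l with
  | nil =>
    simp at hhead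
    subst hhead
    exact ⟨[], hl, hlen⟩
  | cons a l =>
    simp at hhead
    subst hhead
    exact ⟨l ++ [w], hl, by simpa using hlen⟩

open Classical in
/-- Edges inside `S`, oriented by the labeling. -/
noncomputable def E (G : SimpleGraph V) (f : V → ℤ) (S : Finset V) : Finset (V × V) :=
  (S ×ˢ S).filter (fun p => G.Adj p.1 p.2 ∧ f p.1 < f p.2)

lemma mem_E {f : V → ℤ} {S : Finset V} {p : V × V} :
    p ∈ E G f S ↔ (p.1 ∈ S ∧ p.2 ∈ S) ∧ G.Adj p.1 p.2 ∧ f p.1 < f p.2 := by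
  classical
  simp [E]

lemma card_E_le {f : V → ℤ} (hf : NonCross G f) {S : Finset V} (hS : 2 ≤ S.card) :
    (E G f S).card + 3 ≤ 2 * S.card := by
  classical
  rcases (E G f S).eq_empty_or_nonempty with h0 | hne
  · rw [h0, Finset.card_empty]; omega
  have hSne : S.Nonempty := Finset.card_pos.1 (by omega)
  obtain ⟨u, hu, hmin⟩ := Finset.exists_min_image S f hSne
  obtain ⟨w, hw, hmax⟩ := Finset.exists_max_image S f hSne
  set A := (E G f S).filter (fun p => ∀ a ∈ S, G.Adj a p.2 → f p.1 ≤ f a) with hA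
  set B := (E G f S).filter (fun p => ∀ b ∈ S, G.Adj p.1 b → f b ≤ f p.2) with hB
  have hAc : A.card ≤ (S.erase u).card := by
    apply Finset.card_le_card_of_injOn Prod.snd
    · intro p hp
      simp only [hA, Finset.coe_filter, Set.mem_ofPred_eq, mem_E] at hp
      refine Finset.mem_erase.2 ⟨?_, hp.1.1.2⟩
      intro h
      have := hmin _ hp.1.1.1
      have := hp.1.2.2
      rw [h] at this
      omega
    · intro p hp q hq hpq
      simp only [hA, Finset.coe_filter, Set.mem_ofPred_eq, mem_E] at hp hq
      refine Prod.ext (hf.1 (le_antisymm ?_ ?_)) hpq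
      · exact hp.2 _ hq.1.1.1 (hpq ▸ hq.1.2.1)
      · exact hq.2 _ hp.1.1.1 (hpq ▸ hp.1.2.1)
  have hBc : B.card ≤ (S.erase w).card := by
    apply Finset.card_le_card_of_injOn Prod.fst
    · intro p hp
      simp only [hB, Finset.coe_filter, Set.mem_ofPred_eq, mem_E] at hp
      refine Finset.mem_erase.2 ⟨?_, hp.1.1.1⟩
      intro h
      have := hmax _ hp.1.1.2
      have := hp.1.2.2
      rw [h] at this
      omega
    · intro p hp q hq hpq
      simp only [hB, Finset.coe_filter, Set.mem_ofPred_eq, mem_E] at hp hq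
      refine Prod.ext hpq (hf.1 (le_antisymm ?_ ?_))
      · exact hq.2 _ hp.1.1.2 (hpq ▸ hp.1.2.1)
      · exact hp.2 _ hq.1.1.2 (hpq ▸ hq.1.2.1)
  have hsub : E G f S ⊆ A ∪ B := by
    intro p hp
    by_contra hcon
    simp only [hA, hB, Finset.mem_union, Finset.mem_filter, hp, true_and, not_or, not_forall,
      not_le] at hcon
    obtain ⟨⟨a, ha, haa, hfa⟩, ⟨b, hb, hbb, hfb⟩⟩ := hcon
    rw [mem_E] at hp
    exact hf.2 a p.2 p.1 b haa hbb ⟨hfa, hp.2.2, hfb⟩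
  have hint : (A ∩ B).Nonempty := by
    obtain ⟨p, hp, hpmax⟩ := Finset.exists_max_image (E G f S) (fun p => f p.2 - f p.1) hne
    refine ⟨p, ?_⟩
    have hp' := mem_E.1 hp
    simp only [hA, hB, Finset.mem_inter, Finset.mem_filter, hp, true_and]
    constructor
    · intro a ha hap
      by_contra hlt
      have := hpmax (a, p.2) (mem_E.2 ⟨⟨ha, hp'.1.2⟩, hap, by simp only; omega⟩)
      simp only at this
      omega
    · intro b hb hpb
      by_contra hlt
      have := hpmax (p.1, b) (mem_E.2 ⟨⟨hp'.1.1, hb⟩, hpb, by simp only; omega⟩)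
      simp only at this
      omega
  have h1 := Finset.card_le_card hsub
  have h2 := Finset.card_union_add_card_inter A B
  have h3 := Finset.card_pos.2 hint
  rw [Finset.card_erase_of_mem hu] at hAc
  rw [Finset.card_erase_of_mem hw] at hBc
  omega

/-- The block-size invariant. -/
def Inv (G : SimpleGraph V) (f : V → ℤ) (S : Finset V) : Prop :=
  ∃ L : List ℕ, L.sum + 1 = S.card ∧ (E G f S).card + L.length ≤ 2 * L.sum ∧
    (∀ v ∈ S, ∀ s ∈ L, ∃ l, PathIn G S (v :: l) ∧ s ≤ l.length) ∧
    L.Pairwise (fun s t => ∃ l, PathIn G S l ∧ s + t + 1 ≤ l.length)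

lemma SplitAt.card {S S1 S2 : Finset V} {c : V} (h : SplitAt G S S1 S2 c) :
    S.card + 1 = S1.card + S2.card ∧ S1.card < S.card ∧ S2.card < S.card := by
  classical
  obtain ⟨h1, h2, ⟨x, hx, hxc⟩, ⟨y, hy, hyc⟩, h5⟩ := h
  have e1 : S = S1 ∪ S2 := by ext x; simp [h1]
  have e2 : S1 ∩ S2 = {c} := by ext x; simp [h2]
  have h := Finset.card_union_add_card_inter S1 S2
  rw [← e1, e2, Finset.card_singleton] at h
  have hc := (h2 c).2 rfl
  have a1 : 1 < S1.card := Finset.one_lt_card.2 ⟨x, hx, c, hc.1, hxc⟩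
  have a2 : 1 < S2.card := Finset.one_lt_card.2 ⟨y, hy, c, hc.2, hyc⟩
  omega

lemma SplitAt.card_E {S S1 S2 : Finset V} {c : V} (h : SplitAt G S S1 S2 c) (f : V → ℤ) :
    (E G f S).card ≤ (E G f S1).card + (E G f S2).card := by
  classical
  refine le_trans (Finset.card_le_card ?_) (Finset.card_union_le _ _)
  obtain ⟨h1, h2, -, -, h5⟩ := h
  have hc := (h2 c).2 rfl
  intro p hp
  rw [Finset.mem_union, mem_E, mem_E]
  rw [mem_E] at hp
  obtain ⟨⟨ha, hb⟩, hab, hlt⟩ := hp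
  have both : (p.1 ∈ S1 ∧ p.2 ∈ S1) ∨ (p.1 ∈ S2 ∧ p.2 ∈ S2) := by
    by_cases q1 : p.1 = c
    · rw [q1]
      rcases (h1 _).1 hb with h | h
      · exact Or.inl ⟨hc.1, h⟩
      · exact Or.inr ⟨hc.2, h⟩
    by_cases q2 : p.2 = c
    · rw [q2]
      rcases (h1 _).1 ha with h | h
      · exact Or.inl ⟨h, hc.1⟩
      · exact Or.inr ⟨h, hc.2⟩
    rcases (h1 _).1 ha with h | h <;> rcases (h1 _).1 hb with h' | h'
    · exact Or.inl ⟨h, h'⟩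
    · exact absurd hab (h5 _ h _ h' q1 q2)
    · exact absurd hab.symm (h5 _ h' _ h q2 q1)
    · exact Or.inr ⟨h, h'⟩
  exact both.imp (fun h => ⟨h, hab, hlt⟩) (fun h => ⟨h, hab, hlt⟩)

lemma SplitAt.start {S S1 S2 : Finset V} {c : V} (h : SplitAt G S S1 S2 c)
    (hS1 : Conn G S1) {v : V} (hv : v ∈ S1) {s : ℕ}
    (hs : ∃ l, PathIn G S2 (c :: l) ∧ s ≤ l.length) :
    ∃ l, PathIn G S (v :: l) ∧ s ≤ l.length := by
  obtain ⟨q, hq, hql⟩ := hs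
  have hc := (h.2.1 c).2 rfl
  obtain ⟨p, hp, hhead⟩ := hS1.path hv hc.1
  have hg := h.glue hp hq
  cases p with
  | nil =>
    simp at hhead
    subst hhead
    exact ⟨q, hg, hql⟩
  | cons a p =>
    simp at hhead
    subst hhead
    refine ⟨p ++ c :: q, hg, ?_⟩
    simp
    omega

lemma inv_of_split {f : V → ℤ} {S S1 S2 : Finset V} {c : V} (h : SplitAt G S S1 S2 c)
    (c1 : Conn G S1) (c2 : Conn G S2) (i1 : Inv G f S1) (i2 : Inv G f S2) : Inv G f S := by
  obtain ⟨L1, a1, b1, d1, e1⟩ := i1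
  obtain ⟨L2, a2, b2, d2, e2⟩ := i2
  have hcard := h.card
  have hE := h.card_E f
  have hc := (h.2.1 c).2 rfl
  have m1 : ∀ x ∈ S1, x ∈ S := fun x hx => (h.1 x).2 (Or.inl hx)
  have m2 : ∀ x ∈ S2, x ∈ S := fun x hx => (h.1 x).2 (Or.inr hx)
  refine ⟨L1 ++ L2, ?_, ?_, ?_, ?_⟩
  · rw [List.sum_append]; omega
  · rw [List.sum_append, List.length_append]; omega
  · intro v hv s hs
    rw [List.mem_append] at hs
    rcases hs with hs | hs
    · by_cases hv1 : v ∈ S1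
      · obtain ⟨l, hl, hsl⟩ := d1 v hv1 s hs
        exact ⟨l, hl.mono m1, hsl⟩
      · exact h.symm.start c2 (((h.1 v).1 hv).resolve_left hv1) (d1 c hc.1 s hs)
    · by_cases hv2 : v ∈ S2
      · obtain ⟨l, hl, hsl⟩ := d2 v hv2 s hs
        exact ⟨l, hl.mono m2, hsl⟩
      · exact h.start c1 (((h.1 v).1 hv).resolve_right hv2) (d2 c hc.2 s hs)
  · rw [List.pairwise_append]
    refine ⟨e1.imp ?_, e2.imp ?_, ?_⟩
    · rintro s t ⟨l, hl, hh⟩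
      exact ⟨l, hl.mono m1, hh⟩
    · rintro s t ⟨l, hl, hh⟩
      exact ⟨l, hl.mono m2, hh⟩
    · intro s hs t ht
      obtain ⟨p, hp, hps⟩ := d1 c hc.1 s hs
      obtain ⟨q, hq, hqt⟩ := d2 c hc.2 t ht
      have hp' := hp.reverse
      rw [List.reverse_cons] at hp'
      refine ⟨_, h.glue hp' hq, ?_⟩
      simp
      omega

lemma inv_of_conn [Finite V] {f : V → ℤ} (hf : NonCross G f) :
    ∀ (N : ℕ) (S : Finset V), S.card = N → S.Nonempty → Conn G S → Inv G f S := by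
  intro N
  induction N using Nat.strong_induction_on with
  | _ N ih =>
    intro S hN hne hS
    by_cases hsp : ∃ S1 S2 c, SplitAt G S S1 S2 c
    · obtain ⟨S1, S2, c, h⟩ := hsp
      have hc := (h.2.1 c).2 rfl
      have hcard := h.card
      have c1 := h.conn hS
      have c2 := h.symm.conn hS
      exact inv_of_split h c1 c2 (ih _ (by omega) S1 rfl ⟨c, hc.1⟩ c1)
        (ih _ (by omega) S2 rfl ⟨c, hc.2⟩ c2)
    · have hpos := Finset.card_pos.2 hne
      by_cases h1 : S.card = 1
      · refine ⟨[], by simp [h1], ?_, by simp, by simp⟩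
        obtain ⟨a, rfl⟩ := Finset.card_eq_one.1 h1
        have : E G f {a} = ∅ := by
          ext p
          rw [mem_E]
          simp only [Finset.mem_singleton, Finset.notMem_empty, iff_false]
          rintro ⟨⟨h1, h2⟩, -, h3⟩
          rw [h1, h2] at h3
          omega
        simp [this]
      · have := card_E_le hf (S := S) (by omega)
        refine ⟨[S.card - 1], by simp; omega, by simp; omega, ?_, by simp⟩
        intro v hv s hs
        obtain ⟨l, hl, hlen⟩ := ham_path hf hS hsp hv
        refine ⟨l, hl, ?_⟩
        simp at hs
        omega

lemma list_bound (p m : ℕ) (h1 : 2 * m ≤ p) (h2 : p ≤ 2 * m + 1) (L : List ℕ)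
    (hL : L.Pairwise (fun s t => s + t ≤ p)) (hlen : 2 ≤ L.length) :
    L.sum + 2 * m ≤ p + L.length * m := by
  induction L with
  | nil => simp at hlen
  | cons a L ih =>
    rw [List.pairwise_cons] at hL
    by_cases ha : a ≤ m
    · by_cases hl : 2 ≤ L.length
      · have := ih hL.2 hl
        simp only [List.sum_cons, List.length_cons, Nat.add_mul]
        omega
      · match L, hl, hlen, hL with
        | [b], _, _, hL =>
          have := hL.1 b (by simp)
          simp
          omega
        | [], _, hlen, _ => simp at hlen
        | _ :: _ :: _, hl, _, _ => simp at hl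
    · cases L with
      | nil => simp at hlen
      | cons b R =>
        have hb := hL.1 b (by simp)
        have hR : R.sum ≤ R.length * m := by
          have := List.sum_le_card_nsmul R m (fun x hx => by
            have := hL.1 x (by simp [hx])
            omega)
          simpa using this
        simp only [List.sum_cons, List.length_cons, Nat.add_mul]
        omega

lemma contains_of_path {S : Finset V} {l : List V} (h : PathIn G S l) {k : ℕ}
    (hk : k ≤ l.length) : ContainsCopy (SimpleGraph.pathGraph k) G := by
  obtain ⟨h1, h2, -⟩ := h
  rw [List.isChain_iff_getElem] at h2
  refine ⟨⟨fun i => l[i.1]'(by omega), ?_⟩, ?_⟩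
  · intro a b hab
    rw [SimpleGraph.pathGraph_adj] at hab
    rcases hab with hab | hab
    · have := h2 a.1 (by omega)
      simpa [hab] using this
    · have := h2 b.1 (by omega)
      simpa [hab] using this.symm
  · intro a b hab
    have : l[a.1]'(by omega) = l[b.1]'(by omega) := hab
    rw [h1.getElem_inj_iff] at this
    exact Fin.ext this

lemma card_E_univ [Fintype V] {f : V → ℤ} (hf : Function.Injective f) :
    (E G f univ).card = G.edgeSet.ncard := by
  classical
  rw [← Set.ncard_coe_finset]
  apply Set.ncard_congr (fun p _ => s(p.1, p.2))
  · intro p hp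
    rw [Finset.mem_coe, mem_E] at hp
    exact hp.2.1
  · intro p q hp hq hpq
    rw [Finset.mem_coe, mem_E] at hp hq
    rw [Sym2.eq_iff] at hpq
    rcases hpq with ⟨h1, h2⟩ | ⟨h1, h2⟩
    · exact Prod.ext h1 h2
    · have := hp.2.2
      have := hq.2.2
      rw [h1, h2] at *
      omega
  · intro e he
    induction e using Sym2.ind with
    | _ a b =>
      have hab : G.Adj a b := he
      rcases lt_or_gt_of_ne (fun h => hab.ne (hf h)) with h | h
      · exact ⟨(a, b), by rw [Finset.mem_coe, mem_E]; simp [hab, h], rfl⟩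
      · exact ⟨(b, a), by rw [Finset.mem_coe, mem_E]; simp [hab.symm, h], Sym2.eq_swap⟩

lemma conn_univ [Fintype V] (h : G.Connected) : Conn G univ := by
  rintro T ⟨x, -, hx⟩ ⟨y, -, hy⟩
  obtain ⟨p⟩ := h.preconnected x y
  obtain ⟨d, hd, h1, h2⟩ := p.exists_boundary_dart T hx hy
  exact ⟨d.fst, by simp, d.snd, by simp, h1, h2, d.adj⟩

end

lemma upper (n k : ℕ) (hk : 4 ≤ k) (hn : k ≤ n) (G : SimpleGraph (Fin n))
    (ho : IsOuterplanar G) (hc : G.Connected) (hP : ¬ ContainsCopy (SimpleGraph.pathGraph k) G) :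
    ∃ b : ℕ, G.edgeSet.ncard + b + 4 ≤ 2 * n ∧ n + 1 ≤ k + b * (k / 2 - 1) := by
  obtain ⟨f, hf⟩ := ho
  have hf : NonCross G f := hf
  have : Nonempty (Fin n) := hc.nonempty
  obtain ⟨L, h1, h2, h3, h4⟩ := inv_of_conn hf _ univ rfl univ_nonempty (conn_univ hc)
  rw [card_E_univ hf.1] at h2
  simp only [card_univ, Fintype.card_fin] at h1
  have hlen : 2 ≤ L.length := by
    by_contra hlt
    match L, hlt with
    | [], _ => simp at h1; omega
    | [s], _ =>
      obtain ⟨l, hl, hsl⟩ := h3 (Classical.arbitrary _) (mem_univ _) s (by simp)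
      simp at h1
      exact hP (contains_of_path hl (by simp; omega))
    | _ :: _ :: _, hlt => simp at hlt
  have hb := list_bound (k - 2) (k / 2 - 1) (by omega) (by omega) L (h4.imp (by
    rintro s t ⟨l, hl, hst⟩
    by_contra hcon
    exact hP (contains_of_path hl (by omega)))) hlen
  obtain ⟨b, hb'⟩ := Nat.exists_eq_add_of_le hlen
  refine ⟨b, by omega, ?_⟩
  rw [hb', Nat.add_mul] at hb
  omega

/-- Segment index. -/
def seg (d m i : ℕ) : ℕ := (i - 1 - d) / m

/-- The extremal graph: a center joined to disjoint paths. -/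
def fan (n d m : ℕ) : SimpleGraph (Fin n) where
  Adj a b := a ≠ b ∧ (a.1 = 0 ∨ b.1 = 0 ∨
    ((a.1 + 1 = b.1 ∨ b.1 + 1 = a.1) ∧ seg d m a.1 = seg d m b.1))
  symm := ⟨by
    rintro a b ⟨h1, h2⟩
    refine ⟨h1.symm, ?_⟩
    rcases h2 with h | h | ⟨h, h'⟩
    · exact Or.inr (Or.inl h)
    · exact Or.inl h
    · exact Or.inr (Or.inr ⟨h.symm, h'.symm⟩)⟩
  loopless := ⟨fun a h => h.1 rfl⟩

lemma fan_nonCross (n d m : ℕ) : NonCross (fan n d m) (fun i => (i.1 : ℤ)) := by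
  refine ⟨fun a b h => Fin.ext (by simpa using h), ?_⟩
  rintro a b c e ⟨h1, h2⟩ ⟨h3, h4⟩ h
  simp only at h
  omega

lemma fan_connected (n d m : ℕ) (hn : 0 < n) : (fan n d m).Connected := by
  have key : ∀ v, (fan n d m).Reachable ⟨0, hn⟩ v := by
    intro v
    by_cases h : (⟨0, hn⟩ : Fin n) = v
    · rw [h]
    · exact SimpleGraph.Adj.reachable ⟨h, Or.inl rfl⟩
  have : Nonempty (Fin n) := ⟨⟨0, hn⟩⟩
  exact ⟨fun u v => (key u).symm.trans (key v)⟩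

lemma seg_card (d m A : ℕ) (hm : 0 < m) (s : Finset ℕ)
    (hs : ∀ i ∈ s, i ≠ 0 ∧ seg d m i = A) : s.card ≤ m + (if A = 0 then d else 0) := by
  split_ifs with hA
  · have : s ⊆ Finset.Ico 1 (m + d + 1) := by
      intro i hi
      obtain ⟨h1, h2⟩ := hs i hi
      rw [seg, hA, Nat.div_eq_zero_iff] at h2
      rw [Finset.mem_Ico]
      omega
    simpa using Finset.card_le_card this
  · have : s ⊆ Finset.Ico (A * m + d + 1) (A * m + d + 1 + m) := by
      intro i hi
      obtain ⟨h1, h2⟩ := hs i hi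
      rw [seg, Nat.div_eq_iff hm] at h2
      have : m ≤ A * m := Nat.le_mul_of_pos_left _ (by omega)
      rw [Finset.mem_Ico]
      omega
    simpa using Finset.card_le_card this

lemma fan_free (n d m : ℕ) (hm : 0 < m) (k : ℕ) (hk : k = 2 * m + 2 + d) :
    ¬ ContainsCopy (SimpleGraph.pathGraph k) (fan n d m) := by
  classical
  rintro ⟨φ, hφ⟩
  -- extend to natural indices
  set g : ℕ → ℕ := fun i => if h : i < k then (φ ⟨i, h⟩).1 else 0 with hg
  have gv : ∀ i (h : i < k), g i = (φ ⟨i, h⟩).1 := fun i h => by simp [hg, h]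
  have ginj : ∀ i j, i < k → j < k → g i = g j → i = j := by
    intro i j hi hj hij
    rw [gv i hi, gv j hj] at hij
    simpa using hφ (Fin.ext hij)
  have gstep : ∀ i, i + 1 < k → g i ≠ 0 → g (i + 1) ≠ 0 → seg d m (g i) = seg d m (g (i + 1)) := by
    intro i hi h1 h2
    have hadj : (fan n d m).Adj (φ ⟨i, by omega⟩) (φ ⟨i + 1, hi⟩) :=
      φ.map_adj (SimpleGraph.pathGraph_adj.2 (Or.inl rfl))
    rw [gv i (by omega)] at *
    rw [gv (i + 1) hi] at *
    obtain ⟨-, h | h | h⟩ := hadj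
    · exact absurd h h1
    · exact absurd h h2
    · exact h.2
  have up : ∀ i, i < k → (∀ j ≤ i, g j ≠ 0) → seg d m (g i) = seg d m (g 0) := by
    intro i
    induction i with
    | zero => intros; rfl
    | succ i ih =>
      intro hi h
      rw [← ih (by omega) (fun j hj => h j (by omega))]
      exact (gstep i hi (h i (by omega)) (h (i + 1) le_rfl)).symm
  have down : ∀ r, r < k → (∀ j < k, k - 1 - r ≤ j → g j ≠ 0) →
      seg d m (g (k - 1 - r)) = seg d m (g (k - 1)) := by
    intro r
    induction r with
    | zero => intros; rfl
    | succ r ih =>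
      intro hr h
      rw [← ih (by omega) (fun j hj hj' => h j hj (by omega))]
      have e : k - 1 - r = k - 1 - (r + 1) + 1 := by omega
      rw [e]
      exact gstep _ (by omega) (h _ (by omega) (by omega)) (h _ (by omega) (by omega))
  have main : ∀ i < k, g i = 0 ∨ seg d m (g i) = seg d m (g 0) ∨
      seg d m (g i) = seg d m (g (k - 1)) := by
    intro i hi
    by_contra hcon
    simp only [not_or] at hcon
    obtain ⟨h0, hA, hB⟩ := hcon
    have e1 : ∃ j ≤ i, g j = 0 := by
      by_contra h
      exact hA (up i hi (fun j hj hj0 => h ⟨j, hj, hj0⟩))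
    have e2 : ∃ j < k, i ≤ j ∧ g j = 0 := by
      by_contra h
      have := down (k - 1 - i) (by omega) (fun j hj hj' hj0 => h ⟨j, hj, by omega, hj0⟩)
      rw [show k - 1 - (k - 1 - i) = i by omega] at this
      exact hB this
    obtain ⟨j, hj, hj0⟩ := e1
    obtain ⟨j', hj', hij', hj0'⟩ := e2
    have := ginj j j' (by omega) hj' (by rw [hj0, hj0'])
    have : j = i := by omega
    exact h0 (this ▸ hj0)
  set A := seg d m (g 0)
  set B := seg d m (g (k - 1))
  set I := (Finset.range k).image g with hI
  have hIc : I.card = k := by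
    rw [hI, Finset.card_image_of_injOn, Finset.card_range]
    intro i hi j hj hij
    exact ginj i j (by simpa using hi) (by simpa using hj) hij
  have hsub : I ⊆ {0} ∪ (I.filter (fun i => i ≠ 0 ∧ seg d m i = A) ∪
      I.filter (fun i => i ≠ 0 ∧ seg d m i = B)) := by
    intro x hx
    obtain ⟨i, hi, rfl⟩ := Finset.mem_image.1 hx
    have := main i (by simpa using hi)
    simp only [Finset.mem_union, Finset.mem_singleton, Finset.mem_filter, hx, true_and]
    tauto
  have c0 := Finset.card_le_card hsub
  have c1 := Finset.card_union_le {0} (I.filter (fun i => i ≠ 0 ∧ seg d m i = A) ∪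
      I.filter (fun i => i ≠ 0 ∧ seg d m i = B))
  have cA := seg_card d m A hm (I.filter (fun i => i ≠ 0 ∧ seg d m i = A))
    (fun i hi => (Finset.mem_filter.1 hi).2)
  have cB := seg_card d m B hm (I.filter (fun i => i ≠ 0 ∧ seg d m i = B))
    (fun i hi => (Finset.mem_filter.1 hi).2)
  rw [Finset.card_singleton] at c1
  by_cases hAB : A = B
  · rw [hAB, Finset.union_self] at c0 c1
    split_ifs at cB <;> omega
  · have c2 := Finset.card_union_le (I.filter (fun i => i ≠ 0 ∧ seg d m i = A))
      (I.filter (fun i => i ≠ 0 ∧ seg d m i = B))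
    split_ifs at cA cB <;> omega

lemma seg_count (d m N : ℕ) (hN : 1 ≤ N) :
    N - 1 ≤ ((Finset.Ico 1 N).filter (fun i => seg d m i = seg d m (i + 1))).card + seg d m N := by
  induction N, hN using Nat.le_induction with
  | base => simp
  | succ N hN ih =>
    have hmono : seg d m N ≤ seg d m (N + 1) := Nat.div_le_div_right (by omega)
    rw [← Finset.insert_Ico_right_eq_Ico_add_one hN, Finset.filter_insert]
    split_ifs with h
    · rw [Finset.card_insert_of_notMem (by simp)]
      omega
    · omega

lemma fan_edges (n d m : ℕ) (hn : 2 ≤ n) :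
    2 * n ≤ (fan n d m).edgeSet.ncard + seg d m (n - 1) + 3 := by
  classical
  rw [← card_E_univ (fan_nonCross n d m).1]
  set C := (Finset.Ico 1 n).image (fun i => (0, i)) with hC
  set D := ((Finset.Ico 1 (n - 1)).filter
    (fun i => seg d m i = seg d m (i + 1))).image (fun i => (i, i + 1)) with hD
  have cC : C.card = n - 1 := by
    rw [hC, Finset.card_image_of_injective _ (fun a b h => by simpa using h)]
    simp
  have cD := seg_count d m (n - 1) (by omega)
  have cD' : D.card = ((Finset.Ico 1 (n - 1)).filter
    (fun i => seg d m i = seg d m (i + 1))).card :=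
    Finset.card_image_of_injective _ (fun a b h => by simpa using h)
  have hdisj : Disjoint C D := by
    rw [Finset.disjoint_left]
    intro p hp hq
    simp only [hC, hD, Finset.mem_image, Finset.mem_Ico, Finset.mem_filter] at hp hq
    obtain ⟨i, hi, rfl⟩ := hp
    obtain ⟨j, hj, hj'⟩ := hq
    simp only [Prod.mk.injEq] at hj'
    omega
  have hsub : C ∪ D ⊆ (E (fan n d m) (fun i => (i.1 : ℤ)) univ).image
      (fun p => (p.1.1, p.2.1)) := by
    intro p hp
    rw [Finset.mem_union] at hp
    rw [Finset.mem_image]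
    simp only [hC, hD, Finset.mem_image, Finset.mem_Ico, Finset.mem_filter] at hp
    rcases hp with ⟨i, hi, rfl⟩ | ⟨i, hi, rfl⟩
    · refine ⟨(⟨0, by omega⟩, ⟨i, hi.2⟩), mem_E.2 ⟨by simp, ⟨?_, Or.inl rfl⟩, ?_⟩, rfl⟩
      · simp; omega
      · simp; omega
    · refine ⟨(⟨i, by omega⟩, ⟨i + 1, by omega⟩), mem_E.2 ⟨by simp,
        ⟨?_, Or.inr (Or.inr ⟨Or.inl rfl, hi.2⟩)⟩, ?_⟩, rfl⟩
      · simp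
      · simp
  have h1 := Finset.card_le_card hsub
  rw [Finset.card_union_of_disjoint hdisj] at h1
  have h2 := Finset.card_image_le (s := E (fan n d m) (fun i => (i.1 : ℤ)) univ)
    (f := fun p => (p.1.1, p.2.1))
  omega

lemma ceil_le_iff (n k : ℕ) (hk : 4 ≤ k) (b : ℤ) :
    ⌈((n : ℚ) - (k : ℚ) + 1) / (((k / 2 : ℕ) : ℚ) - 1)⌉ ≤ b ↔
      (n : ℤ) + 1 ≤ k + b * ((k / 2 - 1 : ℕ) : ℤ) := by
  have h2 : 1 < k / 2 := by omega
  have h3 : (((k / 2 : ℕ) : ℚ) - 1) = ((k / 2 - 1 : ℕ) : ℚ) := by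
    rw [Nat.cast_sub h2.le]; simp
  have h4 : (0 : ℚ) < ((k / 2 - 1 : ℕ) : ℚ) := by
    rw [Nat.cast_pos]; omega
  rw [h3, Int.ceil_le, div_le_iff₀ h4]
  constructor
  · intro h
    have : (n : ℚ) + 1 ≤ k + b * ((k / 2 - 1 : ℕ) : ℚ) := by linarith
    exact_mod_cast this
  · intro h
    have : (n : ℚ) + 1 ≤ k + b * ((k / 2 - 1 : ℕ) : ℚ) := by exact_mod_cast h
    linarith

end OPPath

theorem exOP'_path (n k : ℕ) (hk : 4 ≤ k) (hn : k ≤ n) :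
    (exOP' n (SimpleGraph.pathGraph k) : ℤ) =
      2 * (n : ℤ) - ⌈((n : ℚ) - (k : ℚ) + 1) / (((k / 2 : ℕ) : ℚ) - 1)⌉ - 4 := by
  have hub : ∀ m ∈ {m : ℕ | ∃ G : SimpleGraph (Fin n), IsOuterplanar G ∧ G.Connected ∧
      ¬ ContainsCopy (SimpleGraph.pathGraph k) G ∧ m = G.edgeSet.ncard},
      (m : ℤ) ≤ 2 * (n : ℤ) - ⌈((n : ℚ) - (k : ℚ) + 1) / (((k / 2 : ℕ) : ℚ) - 1)⌉ - 4 := by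
    rintro m ⟨G, ho, hc, hP, rfl⟩
    obtain ⟨b, h1, h2⟩ := OPPath.upper n k hk hn G ho hc hP
    have := (OPPath.ceil_le_iff n k hk b).2 (by exact_mod_cast h2)
    omega
  have hbdd : BddAbove {m : ℕ | ∃ G : SimpleGraph (Fin n), IsOuterplanar G ∧ G.Connected ∧
      ¬ ContainsCopy (SimpleGraph.pathGraph k) G ∧ m = G.edgeSet.ncard} := by
    refine ⟨(2 * (n : ℤ) - ⌈((n : ℚ) - (k : ℚ) + 1) / (((k / 2 : ℕ) : ℚ) - 1)⌉ - 4).toNat, ?_⟩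
    intro m hm
    have := hub m hm
    omega
  obtain ⟨d, hd⟩ : ∃ d, k = 2 * (k / 2 - 1) + 2 + d := ⟨k - (2 * (k / 2 - 1) + 2), by omega⟩
  have hmem : (OPPath.fan n d (k / 2 - 1)).edgeSet.ncard ∈
      {m : ℕ | ∃ G : SimpleGraph (Fin n), IsOuterplanar G ∧ G.Connected ∧
      ¬ ContainsCopy (SimpleGraph.pathGraph k) G ∧ m = G.edgeSet.ncard} :=
    ⟨_, ⟨_, OPPath.fan_nonCross n d _⟩, OPPath.fan_connected n d _ (by omega),
      OPPath.fan_free n d _ (by omega) k hd, rfl⟩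
  have hle := le_csSup hbdd hmem
  have hin := hub _ (Nat.sSup_mem ⟨_, hmem⟩ hbdd)
  have hedge := OPPath.fan_edges n d (k / 2 - 1) (by omega)
  have hseg : (OPPath.seg d (k / 2 - 1) (n - 1) : ℤ) ≤
      1 + ⌈((n : ℚ) - (k : ℚ) + 1) / (((k / 2 : ℕ) : ℚ) - 1)⌉ := by
    have h := (OPPath.ceil_le_iff n k hk _).1 le_rfl
    set c := ⌈((n : ℚ) - (k : ℚ) + 1) / (((k / 2 : ℕ) : ℚ) - 1)⌉
    have hq : OPPath.seg d (k / 2 - 1) (n - 1) * (k / 2 - 1) ≤ n - 1 - 1 - d :=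
      Nat.div_mul_le_self _ _
    generalize OPPath.seg d (k / 2 - 1) (n - 1) = q at *
    have hm : 0 < k / 2 - 1 := by omega
    generalize k / 2 - 1 = m at *
    by_contra hcon
    have h5 : (c + 2) * (m : ℤ) ≤ q * m :=
      mul_le_mul_of_nonneg_right (by omega) (by omega)
    have h6 : (q : ℤ) * m ≤ ((n - 1 - 1 - d : ℕ) : ℤ) := by exact_mod_cast hq
    have h7 : (c + 2) * (m : ℤ) = c * m + 2 * m := by ring
    omega
  unfold exOP'
  omega
end
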